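/- arXiv:1312.4600 — 2 statements merged into one kernel-verified Lean document; each statement's English description precedes it below -/
import Mathlib

section
/- Let p > 1 and C₀ > 0. There is a constant C = C(p, C₀, K) such that the following holds. Suppose u : {x ∈ ℝ⁴ : 1 ≤ |x| ≤ 4} → ℝ^K is a smooth approximate biharmonic function whose coefficient maps satisfy Σ_{j=1}^{4} (sup_x |a_j(x)| + sup_x |b_j(x)|) ≤ C₀. Then Σ_{j=0}^{4} (∫_{2 ≤ |x| ≤ 3} ‖∇^j u(x)‖^p dx)^{1/p} ≤ C · (∫_{1 ≤ |x| ≤ 4} |u(x)|^p dx)^{1/p}, where ∇^j u denotes the j-th total (Fréchet) derivative of u. -/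
open MeasureTheory Metric

noncomputable section

/-- Helper instances so that operator norms of the higher-order coefficient spaces are found. -/
noncomputable instance (K : ℕ) : SeminormedAddCommGroup
    (EuclideanSpace ℝ (Fin 4) →L[ℝ] EuclideanSpace ℝ (Fin 4) →L[ℝ] EuclideanSpace ℝ (Fin K)) :=
  inferInstance

noncomputable instance (K : ℕ) : NormedSpace ℝ
    (EuclideanSpace ℝ (Fin 4) →L[ℝ] EuclideanSpace ℝ (Fin 4) →L[ℝ] EuclideanSpace ℝ (Fin K)) :=
  inferInstance

/-- The Euclidean Laplacian of a map on ℝ⁴ (as trace of the second derivative). -/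
noncomputable def lap {V : Type*} [NormedAddCommGroup V] [NormedSpace ℝ V]
    (f : EuclideanSpace ℝ (Fin 4) → V) (x : EuclideanSpace ℝ (Fin 4)) : V :=
  ∑ i : Fin 4,
    iteratedFDeriv ℝ 2 f x ![EuclideanSpace.single i (1 : ℝ), EuclideanSpace.single i (1 : ℝ)]

/-- Average of `g` over the sphere of radius `r` centered at `0` in ℝ⁴ with respect to the
3-dimensional Hausdorff (surface) measure. -/
noncomputable def sphereAvg {V : Type*} [NormedAddCommGroup V] [NormedSpace ℝ V]
    (r : ℝ) (g : EuclideanSpace ℝ (Fin 4) → V) : V :=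
  (μH[3] (Metric.sphere (0 : EuclideanSpace ℝ (Fin 4)) r)).toReal⁻¹ •
    ∫ y in Metric.sphere (0 : EuclideanSpace ℝ (Fin 4)) r, g y ∂(μH[3])

/-- The approximate biharmonic equation
`Δ²u = a₁(∇Δu) + a₂(∇²u) + a₃(∇u) + a₄(u) + avg_{∂B_{|x|}}[b₁(∇Δu) + b₂(∇²u) + b₃(∇u) + b₄(u)]`
holding at every point of `S`. -/
def ApproxBiharmonicEqOn {K : ℕ} (S : Set (EuclideanSpace ℝ (Fin 4)))
    (u : EuclideanSpace ℝ (Fin 4) → EuclideanSpace ℝ (Fin K))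
    (a₁ : EuclideanSpace ℝ (Fin 4) →
      (EuclideanSpace ℝ (Fin 4) →L[ℝ] EuclideanSpace ℝ (Fin K)) →L[ℝ] EuclideanSpace ℝ (Fin K))
    (a₂ : EuclideanSpace ℝ (Fin 4) →
      (EuclideanSpace ℝ (Fin 4) →L[ℝ] EuclideanSpace ℝ (Fin 4) →L[ℝ] EuclideanSpace ℝ (Fin K))
        →L[ℝ] EuclideanSpace ℝ (Fin K))
    (a₃ : EuclideanSpace ℝ (Fin 4) →
      (EuclideanSpace ℝ (Fin 4) →L[ℝ] EuclideanSpace ℝ (Fin K)) →L[ℝ] EuclideanSpace ℝ (Fin K))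
    (a₄ : EuclideanSpace ℝ (Fin 4) →
      EuclideanSpace ℝ (Fin K) →L[ℝ] EuclideanSpace ℝ (Fin K))
    (b₁ : EuclideanSpace ℝ (Fin 4) →
      (EuclideanSpace ℝ (Fin 4) →L[ℝ] EuclideanSpace ℝ (Fin K)) →L[ℝ] EuclideanSpace ℝ (Fin K))
    (b₂ : EuclideanSpace ℝ (Fin 4) →
      (EuclideanSpace ℝ (Fin 4) →L[ℝ] EuclideanSpace ℝ (Fin 4) →L[ℝ] EuclideanSpace ℝ (Fin K))
        →L[ℝ] EuclideanSpace ℝ (Fin K))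
    (b₃ : EuclideanSpace ℝ (Fin 4) →
      (EuclideanSpace ℝ (Fin 4) →L[ℝ] EuclideanSpace ℝ (Fin K)) →L[ℝ] EuclideanSpace ℝ (Fin K))
    (b₄ : EuclideanSpace ℝ (Fin 4) →
      EuclideanSpace ℝ (Fin K) →L[ℝ] EuclideanSpace ℝ (Fin K)) : Prop :=
  ∀ x ∈ S,
    lap (lap u) x =
      a₁ x (fderiv ℝ (lap u) x) + a₂ x (fderiv ℝ (fderiv ℝ u) x) + a₃ x (fderiv ℝ u x) +
        a₄ x (u x) +
      sphereAvg ‖x‖ (fun y =>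
        b₁ y (fderiv ℝ (lap u) y) + b₂ y (fderiv ℝ (fderiv ℝ u) y) + b₃ y (fderiv ℝ u y) +
          b₄ y (u y))

local notation "E4" => EuclideanSpace ℝ (Fin 4)

/-- The partial derivative of `f` in the `i`-th coordinate direction. -/
def pd {V : Type*} [NormedAddCommGroup V] [NormedSpace ℝ V] (i : Fin 4) (f : E4 → V) (x : E4) : V :=
  fderiv ℝ f x (EuclideanSpace.single i (1 : ℝ))

/-- The iterated partial derivative of `f` along a list of coordinate directions. -/
def pds {V : Type*} [NormedAddCommGroup V] [NormedSpace ℝ V] : List (Fin 4) → (E4 → V) → E4 → V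
  | [], f => f
  | i :: l, f => pd i (pds l f)

/-- The Laplacian written through partial derivatives. -/
def lapl (f : E4 → ℝ) (x : E4) : ℝ := ∑ i : Fin 4, pd i (pd i f) x

/-- Smooth compactly supported real functions on `ℝ⁴`. -/
structure TestFun (f : E4 → ℝ) : Prop where
  smooth : ContDiff ℝ (⊤ : ℕ∞) f
  supp : HasCompactSupport f

lemma ContDiff.pd {V : Type*} [NormedAddCommGroup V] [NormedSpace ℝ V] {f : E4 → V}
    (hf : ContDiff ℝ (⊤ : ℕ∞) f) (i : Fin 4) : ContDiff ℝ (⊤ : ℕ∞) (pd i f) := by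
  have : ContDiff ℝ (⊤ : ℕ∞) (fderiv ℝ f) := hf.fderiv_right (by simp)
  exact this.clm_apply contDiff_const

lemma ContDiff.pds {V : Type*} [NormedAddCommGroup V] [NormedSpace ℝ V] {f : E4 → V}
    (hf : ContDiff ℝ (⊤ : ℕ∞) f) (l : List (Fin 4)) : ContDiff ℝ (⊤ : ℕ∞) (pds l f) := by
  induction l with
  | nil => exact hf
  | cons i l ih => exact ih.pd i

lemma ContDiff.diffble {V : Type*} [NormedAddCommGroup V] [NormedSpace ℝ V] {f : E4 → V}
    (hf : ContDiff ℝ (⊤ : ℕ∞) f) : Differentiable ℝ f := hf.differentiable (by simp)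

namespace TestFun

variable {f g : E4 → ℝ}

lemma continuous (hf : TestFun f) : Continuous f := hf.smooth.continuous

lemma diffble (hf : TestFun f) : Differentiable ℝ f := hf.smooth.diffble

lemma integrable (hf : TestFun f) : Integrable f :=
  hf.continuous.integrable_of_hasCompactSupport hf.supp

lemma pd (hf : TestFun f) (i : Fin 4) : TestFun (pd i f) := by
  refine ⟨hf.smooth.pd i, ?_⟩
  exact (hf.supp.fderiv ℝ).comp_left (g := fun L : E4 →L[ℝ] ℝ => L (EuclideanSpace.single i 1)) rfl

lemma pds (hf : TestFun f) (l : List (Fin 4)) : TestFun (pds l f) := by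
  induction l with
  | nil => exact hf
  | cons i l ih => exact ih.pd i

lemma add (hf : TestFun f) (hg : TestFun g) : TestFun (fun x => f x + g x) :=
  ⟨hf.smooth.add hg.smooth, hf.supp.add hg.supp⟩

lemma const_mul (hf : TestFun f) (c : ℝ) : TestFun (fun x => c * f x) :=
  ⟨contDiff_const.mul hf.smooth, hf.supp.mul_left⟩

lemma mul_left (hg : TestFun g) (hf : ContDiff ℝ (⊤ : ℕ∞) f) : TestFun (fun x => f x * g x) :=
  ⟨hf.mul hg.smooth, hg.supp.mul_left⟩

lemma zero : TestFun (fun _ => 0) := ⟨contDiff_const, HasCompactSupport.zero⟩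

lemma sum {ι : Type*} (s : Finset ι) {F : ι → E4 → ℝ} (h : ∀ i ∈ s, TestFun (F i)) :
    TestFun (fun x => ∑ i ∈ s, F i x) := by
  classical
  induction s using Finset.induction_on with
  | empty => simpa using zero
  | insert a s ha ih =>
    simp only [Finset.sum_insert ha]
    exact (h a (by simp)).add (ih fun i hi => h i (by simp [hi]))

lemma lapl (hf : TestFun f) : TestFun (lapl f) :=
  TestFun.sum _ fun i _ => (hf.pd i).pd i

lemma integral_pd_mul (hf : TestFun f) (hg : TestFun g) (i : Fin 4) :
    ∫ x, f x * _root_.pd i g x = - ∫ x, _root_.pd i f x * g x :=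
  integral_mul_fderiv_eq_neg_fderiv_mul_of_integrable
    (f := f) (g := g) (v := EuclideanSpace.single i 1)
    (hg.mul_left (hf.pd i).smooth).integrable ((hg.pd i).mul_left hf.smooth).integrable
    (hg.mul_left hf.smooth).integrable (fun x _ => hf.diffble x) (fun x _ => hg.diffble x)

lemma bounded (hf : TestFun f) : ∃ C, 0 < C ∧ ∀ x, |f x| ≤ C := by
  obtain ⟨C, hC⟩ := hf.supp.exists_bound_of_continuous hf.continuous
  exact ⟨max C 1, by positivity, fun x => (hC x).trans (le_max_left _ _)⟩

lemma lipschitz (hf : TestFun f) : ∃ C, 0 < C ∧ ∀ x y, |f x - f y| ≤ C * ‖x - y‖ := by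
  obtain ⟨C, hC⟩ := ContDiff.lipschitzWith_of_hasCompactSupport hf.supp hf.smooth (by simp)
  refine ⟨C + 1, by positivity, fun x y => ?_⟩
  have := hC.dist_le_mul x y
  rw [Real.dist_eq, dist_eq_norm] at this
  nlinarith [norm_nonneg (x - y)]

end TestFun

lemma pd_comm {f : E4 → ℝ} (hf : ContDiff ℝ (⊤ : ℕ∞) f) (i j : Fin 4) :
    pd i (pd j f) = pd j (pd i f) := by
  have h1 : Differentiable ℝ (fderiv ℝ f) :=
    (hf.fderiv_right (m := (⊤ : ℕ∞)) (by simp)).differentiable (by simp)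
  have key : ∀ (a b : Fin 4) (x : E4), pd a (pd b f) x =
      fderiv ℝ (fderiv ℝ f) x (EuclideanSpace.single a 1) (EuclideanSpace.single b 1) := by
    intro a b x
    unfold pd
    rw [fderiv_clm_apply (h1 x) (differentiableAt_const _)]
    simp
  ext x
  rw [key, key]
  exact (hf.contDiffAt.isSymmSndFDerivAt
    (by simp; exact WithTop.coe_le_coe.2 (le_top : (2 : ℕ∞) ≤ ⊤))) _ _

lemma pd_sum {ι : Type*} (s : Finset ι) {F : ι → E4 → ℝ} (h : ∀ i ∈ s, Differentiable ℝ (F i))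
    (j : Fin 4) : pd j (fun x => ∑ i ∈ s, F i x) = fun x => ∑ i ∈ s, pd j (F i) x := by
  ext x
  unfold pd
  rw [fderiv_fun_sum fun i hi => h i hi x]
  simp

lemma pd_sub {f g : E4 → ℝ} (hf : Differentiable ℝ f) (hg : Differentiable ℝ g) (j : Fin 4) :
    pd j (fun x => f x - g x) = fun x => pd j f x - pd j g x := by
  ext x
  unfold pd
  rw [fderiv_fun_sub (hf x) (hg x)]
  simp

lemma pd_const_mul {f : E4 → ℝ} (hf : Differentiable ℝ f) (c : ℝ) (j : Fin 4) :
    pd j (fun x => c * f x) = fun x => c * pd j f x := by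
  ext x
  unfold pd
  rw [fderiv_const_mul (hf x)]
  simp

lemma pds_sum {ι : Type*} (s : Finset ι) {F : ι → E4 → ℝ}
    (h : ∀ i ∈ s, ContDiff ℝ (⊤ : ℕ∞) (F i)) (l : List (Fin 4)) :
    pds l (fun x => ∑ i ∈ s, F i x) = fun x => ∑ i ∈ s, pds l (F i) x := by
  induction l with
  | nil => rfl
  | cons j l ih =>
    simp only [pds]
    rw [ih, pd_sum s fun i hi => ((h i hi).pds l).diffble]

lemma pd_lapl {f : E4 → ℝ} (hf : ContDiff ℝ (⊤ : ℕ∞) f) (j : Fin 4) :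
    pd j (lapl f) = lapl (pd j f) := by
  have : lapl f = fun x => ∑ i : Fin 4, pd i (pd i f) x := rfl
  rw [this, pd_sum _ fun i _ => ((hf.pd i).pd i).diffble]
  ext x
  refine Finset.sum_congr rfl fun i _ => ?_
  rw [pd_comm (hf.pd i), pd_comm hf j i]

lemma pds_lapl {f : E4 → ℝ} (hf : ContDiff ℝ (⊤ : ℕ∞) f) (l : List (Fin 4)) :
    pds l (lapl f) = lapl (pds l f) := by
  induction l with
  | nil => rfl
  | cons j l ih => simp only [pds]; rw [ih, pd_lapl (hf.pds l)]

/-- Each second derivative of a test function is controlled in `L²` by its Laplacian. -/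
lemma integral_sq_pd_pd_le {f : E4 → ℝ} (hf : TestFun f) (i j : Fin 4) :
    ∫ x, (pd i (pd j f) x) ^ 2 ≤ ∫ x, (lapl f x) ^ 2 := by
  have swap : ∀ a b : Fin 4, ∫ x, (pd a (pd b f) x) ^ 2 =
      ∫ x, pd a (pd a f) x * pd b (pd b f) x := by
    intro a b
    have h1 := ((hf.pd b).pd a).integral_pd_mul (hf.pd b) a
    have h2 := ((hf.pd a).pd a).integral_pd_mul (hf.pd b) b
    rw [h2]
    simp only [sq]
    rw [h1, pd_comm (hf.pd a).smooth b a, pd_comm hf.smooth b a]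
  have tot : ∫ x, (lapl f x) ^ 2 = ∑ a : Fin 4, ∑ b : Fin 4, ∫ x, (pd a (pd b f) x) ^ 2 := by
    have hI : ∀ a b : Fin 4, Integrable fun x => pd a (pd a f) x * pd b (pd b f) x := fun a b =>
      (((hf.pd b).pd b).mul_left ((hf.pd a).pd a).smooth).integrable
    simp only [swap]
    have : ∀ x, (lapl f x) ^ 2 = ∑ a : Fin 4, ∑ b : Fin 4, pd a (pd a f) x * pd b (pd b f) x := by
      intro x
      rw [sq, lapl, Finset.sum_mul_sum]
    simp only [this]
    rw [integral_finsetSum _ fun a _ => integrable_finsetSum _ fun b _ => hI a b]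
    refine Finset.sum_congr rfl fun a _ => ?_
    rw [integral_finsetSum _ fun b _ => hI a b]
  rw [tot]
  have nn : ∀ a b : Fin 4, 0 ≤ ∫ x, (pd a (pd b f) x) ^ 2 := fun a b =>
    integral_nonneg fun x => sq_nonneg _
  exact (Finset.single_le_sum (f := fun b => ∫ x, (pd i (pd b f) x) ^ 2)
    (fun b _ => nn i b) (Finset.mem_univ j)).trans
    (Finset.single_le_sum (f := fun a => ∑ b, ∫ x, (pd a (pd b f) x) ^ 2)
      (fun a _ => Finset.sum_nonneg fun b _ => nn a b) (Finset.mem_univ i))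

/-- Each fourth derivative of a test function is controlled in `L²` by its bi-Laplacian. -/
lemma integral_sq_pds_le {f : E4 → ℝ} (hf : TestFun f) {l : List (Fin 4)}
    (hl : l.length = 4) : ∫ x, (pds l f x) ^ 2 ≤ ∫ x, (lapl (lapl f) x) ^ 2 := by
  obtain ⟨a, b, c, d, rfl⟩ := List.length_eq_four.mp hl
  simp only [pds]
  refine (integral_sq_pd_pd_le ((hf.pd d).pd c) a b).trans ?_
  rw [← pd_lapl (hf.pd d).smooth, ← pd_lapl hf.smooth]
  exact integral_sq_pd_pd_le hf.lapl c d

/-- Convolution of real functions on `ℝ⁴`. -/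
def cv (f g : E4 → ℝ) (x : E4) : ℝ := ∫ y, f y * g (x - y)

lemma cv_eq_convolution (f g : E4 → ℝ) :
    cv f g = convolution f g (ContinuousLinearMap.mul ℝ ℝ) volume := rfl

lemma cv_eq_swap (f g : E4 → ℝ) (x : E4) : cv f g x = ∫ y, f (x - y) * g y := by
  unfold cv
  rw [← integral_sub_left_eq_self (fun y => f y * g (x - y)) volume x]
  simp

lemma cv_comm (f g : E4 → ℝ) : cv f g = cv g f := by
  ext x
  rw [cv_eq_swap]
  simp only [cv, mul_comm]

lemma pd_cv_right {f g : E4 → ℝ} (hf : LocallyIntegrable f) (hg : TestFun g) (i : Fin 4) :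
    pd i (cv f g) = cv f (pd i g) := by
  ext x
  unfold pd
  rw [cv_eq_convolution, (hg.supp.hasFDerivAt_convolution_right
    (ContinuousLinearMap.mul ℝ ℝ) hf (hg.smooth.of_le (by simp)) x).fderiv]
  rw [convolution_precompR_apply _ hf (hg.supp.fderiv ℝ)
    (hg.smooth.continuous_fderiv (by simp))]
  rfl

lemma TestFun.cv {f g : E4 → ℝ} (hf : TestFun f) (hg : TestFun g) : TestFun (cv f g) := by
  rw [cv_eq_convolution]
  exact ⟨hg.supp.contDiff_convolution_right (ContinuousLinearMap.mul ℝ ℝ)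
    hf.integrable.locallyIntegrable hg.smooth,
    hf.supp.convolution (ContinuousLinearMap.mul ℝ ℝ) hg.supp⟩

lemma pds_cv_right {f g : E4 → ℝ} (hf : LocallyIntegrable f) (hg : TestFun g)
    (l : List (Fin 4)) : pds l (cv f g) = cv f (pds l g) := by
  induction l with
  | nil => rfl
  | cons i l ih => simp only [pds]; rw [ih, pd_cv_right hf (hg.pds l)]

lemma pds_cv_left {f g : E4 → ℝ} (hf : TestFun f) (hg : TestFun g)
    (l : List (Fin 4)) : pds l (cv f g) = cv (pds l f) g := by
  rw [cv_comm, pds_cv_right hg.integrable.locallyIntegrable hf, cv_comm]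

lemma cv_integrand_integrable {f g : E4 → ℝ} (hf : LocallyIntegrable f) (hg : TestFun g)
    (x : E4) : Integrable fun y => f y * g (x - y) :=
  hg.supp.convolutionExists_right (ContinuousLinearMap.mul ℝ ℝ) hf hg.continuous x

lemma cv_sum {ι : Type*} (s : Finset ι) {f : E4 → ℝ} {G : ι → E4 → ℝ} (hf : LocallyIntegrable f)
    (hG : ∀ i ∈ s, TestFun (G i)) (x : E4) :
    cv f (fun x => ∑ i ∈ s, G i x) x = ∑ i ∈ s, cv f (G i) x := by
  simp only [cv, Finset.mul_sum]
  exact integral_finsetSum _ fun i hi => cv_integrand_integrable hf (hG i hi) x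

lemma cv_sub {f g h : E4 → ℝ} (hf : LocallyIntegrable f) (hg : TestFun g) (hh : TestFun h)
    (x : E4) : cv f (fun x => g x - h x) x = cv f g x - cv f h x := by
  simp only [cv, mul_sub]
  exact integral_sub (cv_integrand_integrable hf hg x) (cv_integrand_integrable hf hh x)

lemma lapl_cv_right {f g : E4 → ℝ} (hf : LocallyIntegrable f) (hg : TestFun g) :
    lapl (cv f g) = cv f (lapl g) := by
  ext x
  have : lapl g = fun x => ∑ i : Fin 4, pd i (pd i g) x := rfl
  rw [this, cv_sum _ hf fun i _ => (hg.pd i).pd i]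
  refine Finset.sum_congr rfl fun i _ => ?_
  rw [pd_cv_right hf hg, pd_cv_right hf (hg.pd i)]

lemma lapl_cv_left {f g : E4 → ℝ} (hf : TestFun f) (hg : TestFun g) :
    lapl (cv f g) = cv (lapl f) g := by
  rw [cv_comm, lapl_cv_right hg.integrable.locallyIntegrable hf, cv_comm]

/-- Moving all derivatives between the factors of a convolution. -/
lemma cv_pds_bilapl {f g : E4 → ℝ} (hf : TestFun f) (hg : TestFun g) (l : List (Fin 4)) :
    cv (pds l f) (lapl (lapl g)) = cv (lapl (lapl f)) (pds l g) := by
  rw [← lapl_cv_right (hf.pds l).integrable.locallyIntegrable hg.lapl,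
    ← lapl_cv_right (hf.pds l).integrable.locallyIntegrable hg, ← pds_cv_left hf hg,
    ← pds_lapl (hf.cv hg).smooth, ← pds_lapl (hf.cv hg).lapl.smooth,
    lapl_cv_left hf hg, lapl_cv_left hf.lapl hg,
    pds_cv_right hf.lapl.lapl.integrable.locallyIntegrable hg]

/-- Volume of the unit ball of `ℝ⁴`. -/
def ballVol : ℝ := volume.real (closedBall (0 : E4) 1)

lemma ballVol_nonneg : 0 ≤ ballVol := measureReal_nonneg

lemma volume_real_closedBall (x : E4) {r : ℝ} (hr : 0 ≤ r) :
    volume.real (closedBall x r) = r ^ 4 * ballVol := by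
  rw [ballVol, Measure.real, Measure.addHaar_closedBall' _ _ hr]
  simp [Measure.real, ENNReal.toReal_mul, ENNReal.toReal_ofReal (pow_nonneg hr 4)]

/-- A convolution with a bounded kernel supported in a ball. -/
lemma abs_cv_le {f K : E4 → ℝ} {x : E4} {r A : ℝ}
    (hK : ∀ z, r < ‖z‖ → K z = 0) (hKA : ∀ z, |K z| ≤ A)
    (hf : IntegrableOn f (closedBall x r)) :
    |cv f K x| ≤ A * ∫ y in closedBall x r, |f y| := by
  have h0 : ∀ y, y ∉ closedBall x r → f y * K (x - y) = 0 := by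
    intro y hy
    rw [hK, mul_zero]
    rw [mem_closedBall, dist_comm, dist_eq_norm] at hy
    exact not_le.mp hy
  have e : cv f K x = ∫ y in closedBall x r, f y * K (x - y) :=
    (setIntegral_eq_integral_of_forall_compl_eq_zero h0).symm
  rw [e, ← integral_const_mul, ← Real.norm_eq_abs]
  refine (norm_integral_le_integral_norm _).trans ?_
  refine integral_mono_of_nonneg (ae_of_all _ fun y => norm_nonneg _) (hf.abs.const_mul A)
    (ae_of_all _ fun y => ?_)
  simp only [norm_mul, Real.norm_eq_abs]
  nlinarith [hKA (x - y), abs_nonneg (f y)]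

lemma setIntegral_abs_le {f : E4 → ℝ} {x : E4} {r M : ℝ} (hr : 0 ≤ r)
    (hf : ∀ y ∈ closedBall x r, |f y| ≤ M) :
    ∫ y in closedBall x r, |f y| ≤ M * (r ^ 4 * ballVol) := by
  have := norm_setIntegral_le_of_norm_le_const (μ := volume) (s := closedBall x r)
    (f := fun y => |f y|) (C := M) measure_closedBall_lt_top
    (fun y hy => by simpa using hf y hy)
  rw [volume_real_closedBall x hr] at this
  exact (le_abs_self _).trans this

lemma abs_cv_le_of_bound {f K : E4 → ℝ} {x : E4} {r A M : ℝ} (hr : 0 ≤ r)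
    (hK : ∀ z, r < ‖z‖ → K z = 0) (hKA : ∀ z, |K z| ≤ A)
    (hf : IntegrableOn f (closedBall x r)) (hfM : ∀ y ∈ closedBall x r, |f y| ≤ M) :
    |cv f K x| ≤ A * (M * (r ^ 4 * ballVol)) := by
  have hA : 0 ≤ A := (abs_nonneg _).trans (hKA 0)
  exact (abs_cv_le hK hKA hf).trans
    (mul_le_mul_of_nonneg_left (setIntegral_abs_le hr hfM) hA)

/-- Oscillation of a convolution with a Lipschitz kernel supported in a ball. -/
lemma abs_cv_sub_cv_le {f K : E4 → ℝ} {x x₀ : E4} {r A M : ℝ} (hr : 0 ≤ r)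
    (hKs : TestFun K) (hfi : LocallyIntegrable f)
    (hK : ∀ z, r < ‖z‖ → K z = 0) (hKA : ∀ z w, |K z - K w| ≤ A * ‖z - w‖)
    (hx : ‖x - x₀‖ ≤ r) (hA : 0 ≤ A)
    (hfM : ∀ y ∈ closedBall x₀ (2 * r), |f y| ≤ M) :
    |cv f K x - cv f K x₀| ≤ A * ‖x - x₀‖ * (M * ((2 * r) ^ 4 * ballVol)) := by
  have hsub : cv f K x - cv f K x₀ = ∫ y, f y * (K (x - y) - K (x₀ - y)) := by
    simp only [cv, mul_sub]
    exact (integral_sub (cv_integrand_integrable hfi hKs x)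
      (cv_integrand_integrable hfi hKs x₀)).symm
  have h0 : ∀ y, y ∉ closedBall x₀ (2 * r) → f y * (K (x - y) - K (x₀ - y)) = 0 := by
    intro y hy
    rw [mem_closedBall, dist_comm, dist_eq_norm, not_le] at hy
    have : ‖x₀ - y‖ ≤ ‖x - y‖ + ‖x - x₀‖ := by
      have := norm_sub_le (x - y) (x - x₀)
      rwa [show x - y - (x - x₀) = x₀ - y by abel] at this
    rw [hK, hK, sub_zero, mul_zero] <;> linarith
  rw [hsub, ← setIntegral_eq_integral_of_forall_compl_eq_zero h0]
  have hi : IntegrableOn f (closedBall x₀ (2 * r)) :=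
    hfi.integrableOn_isCompact (isCompact_closedBall _ _)
  calc |∫ y in closedBall x₀ (2 * r), f y * (K (x - y) - K (x₀ - y))|
      ≤ ∫ y in closedBall x₀ (2 * r), (A * ‖x - x₀‖) * |f y| := by
        rw [← Real.norm_eq_abs]
        refine (norm_integral_le_integral_norm _).trans ?_
        refine integral_mono_of_nonneg (ae_of_all _ fun y => norm_nonneg _)
          (hi.abs.const_mul _) (ae_of_all _ fun y => ?_)
        simp only [norm_mul, Real.norm_eq_abs]
        have := hKA (x - y) (x₀ - y)
        rw [sub_sub_sub_cancel_right] at this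
        nlinarith [abs_nonneg (f y)]
    _ = (A * ‖x - x₀‖) * ∫ y in closedBall x₀ (2 * r), |f y| := integral_const_mul _ _
    _ ≤ _ := mul_le_mul_of_nonneg_left (setIntegral_abs_le (by linarith) hfM) (by positivity)

/-- Dilation of a function by the factor `s`. -/
def dil (s : ℝ) (f : E4 → ℝ) (x : E4) : ℝ := f (s⁻¹ • x)

lemma pd_dil (s : ℝ) {f : E4 → ℝ} (hf : Differentiable ℝ f) (i : Fin 4) :
    pd i (dil s f) = fun x => s⁻¹ * dil s (pd i f) x := by
  ext x
  have h : HasFDerivAt (dil s f)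
      ((fderiv ℝ f (s⁻¹ • x)).comp (s⁻¹ • ContinuousLinearMap.id ℝ E4)) x :=
    (hf (s⁻¹ • x)).hasFDerivAt.comp x ((s⁻¹ • ContinuousLinearMap.id ℝ E4).hasFDerivAt)
  unfold pd
  rw [h.fderiv]
  simp [dil]

lemma ContDiff.dil {f : E4 → ℝ} (hf : ContDiff ℝ (⊤ : ℕ∞) f) (s : ℝ) :
    ContDiff ℝ (⊤ : ℕ∞) (dil s f) := hf.comp (contDiff_const_smul _)

lemma TestFun.dil {f : E4 → ℝ} (hf : TestFun f) {s : ℝ} (hs : s ≠ 0) : TestFun (dil s f) :=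
  ⟨hf.smooth.dil s, hf.supp.comp_homeomorph (Homeomorph.smulOfNeZero s⁻¹ (inv_ne_zero hs))⟩

lemma pds_dil (s : ℝ) {f : E4 → ℝ} (hf : ContDiff ℝ (⊤ : ℕ∞) f) (l : List (Fin 4)) :
    pds l (dil s f) = fun x => (s⁻¹) ^ l.length * dil s (pds l f) x := by
  induction l with
  | nil => simp [pds]
  | cons i l ih =>
    simp only [pds, ih, List.length_cons]
    rw [pd_const_mul ((hf.pds l).dil s).diffble, pd_dil s (hf.pds l).diffble]
    ext x
    ring

lemma lapl_dil (s : ℝ) {f : E4 → ℝ} (hf : ContDiff ℝ (⊤ : ℕ∞) f) :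
    lapl (dil s f) = fun x => s⁻¹ ^ 2 * dil s (lapl f) x := by
  ext x
  have := fun i => congrFun (pds_dil s hf [i, i]) x
  simp only [pds, List.length_cons, List.length_nil] at this
  simp only [lapl, this, dil, Finset.mul_sum]

lemma lapl_const_mul {f : E4 → ℝ} (hf : ContDiff ℝ (⊤ : ℕ∞) f) (c : ℝ) :
    lapl (fun x => c * f x) = fun x => c * lapl f x := by
  ext x
  simp only [lapl, Finset.mul_sum]
  refine Finset.sum_congr rfl fun i _ => ?_
  rw [pd_const_mul hf.diffble, pd_const_mul (hf.pd i).diffble]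

lemma ContDiff.lapl {f : E4 → ℝ} (hf : ContDiff ℝ (⊤ : ℕ∞) f) :
    ContDiff ℝ (⊤ : ℕ∞) (lapl f) :=
  ContDiff.sum fun i _ => (hf.pd i).pd i

lemma bilapl_dil (s : ℝ) {f : E4 → ℝ} (hf : ContDiff ℝ (⊤ : ℕ∞) f) :
    lapl (lapl (dil s f)) = fun x => s⁻¹ ^ 4 * dil s (lapl (lapl f)) x := by
  rw [lapl_dil s hf, lapl_const_mul (hf.lapl.dil s), lapl_dil s hf.lapl]
  ext x
  ring

/-- The Laplacian on `ℝ⁴` of a radial function, as an operator on its profile in `s = ‖x‖²`. -/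
def radialLap (γ : ℝ → ℝ) (s : ℝ) : ℝ := 4 * s * deriv (deriv γ) s + 8 * deriv γ s

lemma ContDiff.deriv_top {γ : ℝ → ℝ} (hγ : ContDiff ℝ (⊤ : ℕ∞) γ) :
    ContDiff ℝ (⊤ : ℕ∞) (deriv γ) := (contDiff_infty_iff_deriv.mp hγ).2

lemma ContDiff.radialLap {γ : ℝ → ℝ} (hγ : ContDiff ℝ (⊤ : ℕ∞) γ) :
    ContDiff ℝ (⊤ : ℕ∞) (radialLap γ) :=
  ((contDiff_const.mul contDiff_id).mul hγ.deriv_top.deriv_top).add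
    (contDiff_const.mul hγ.deriv_top)

lemma pd_coord (i : Fin 4) : pd i (fun x : E4 => x i) = fun _ => 1 := by
  ext x
  unfold pd
  have : HasFDerivAt (fun x : E4 => x i) (EuclideanSpace.proj (𝕜 := ℝ) i : E4 →L[ℝ] ℝ) x :=
    (EuclideanSpace.proj (𝕜 := ℝ) i : E4 →L[ℝ] ℝ).hasFDerivAt
  rw [this.fderiv]
  simp

lemma pd_mul {f g : E4 → ℝ} (hf : Differentiable ℝ f) (hg : Differentiable ℝ g) (i : Fin 4) :
    pd i (fun x => f x * g x) = fun x => f x * pd i g x + pd i f x * g x := by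
  ext x
  unfold pd
  rw [fderiv_fun_mul (hf x) (hg x)]
  simp [mul_comm]

lemma pd_radial {γ : ℝ → ℝ} (hγ : Differentiable ℝ γ) (i : Fin 4) :
    pd i (fun x : E4 => γ (‖x‖ ^ 2)) = fun x => deriv γ (‖x‖ ^ 2) * (2 * x i) := by
  ext x
  have h1 : HasFDerivAt (fun x : E4 => ‖x‖ ^ 2) (2 • (innerSL ℝ x)) x :=
    (hasStrictFDerivAt_norm_sq x).hasFDerivAt
  have h2 := (hγ (‖x‖ ^ 2)).hasDerivAt.comp_hasFDerivAt x h1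
  unfold pd
  rw [HasFDerivAt.fderiv (f := fun x : E4 => γ (‖x‖ ^ 2)) h2]
  simp [EuclideanSpace.inner_single_right]

lemma contDiff_radial {γ : ℝ → ℝ} (hγ : ContDiff ℝ (⊤ : ℕ∞) γ) :
    ContDiff ℝ (⊤ : ℕ∞) (fun x : E4 => γ (‖x‖ ^ 2)) := hγ.comp (contDiff_norm_sq ℝ)

lemma contDiff_coord (i : Fin 4) : ContDiff ℝ (⊤ : ℕ∞) (fun x : E4 => x i) :=
  (EuclideanSpace.proj (𝕜 := ℝ) i : E4 →L[ℝ] ℝ).contDiff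

lemma lapl_radial {γ : ℝ → ℝ} (hγ : ContDiff ℝ (⊤ : ℕ∞) γ) :
    lapl (fun x : E4 => γ (‖x‖ ^ 2)) = fun x => radialLap γ (‖x‖ ^ 2) := by
  ext x
  have hd := hγ.deriv_top
  unfold lapl radialLap
  have : ∀ i : Fin 4, pd i (pd i (fun x : E4 => γ (‖x‖ ^ 2))) x =
      4 * (x i) ^ 2 * deriv (deriv γ) (‖x‖ ^ 2) + 2 * deriv γ (‖x‖ ^ 2) := by
    intro i
    rw [pd_radial (hγ.differentiable (by simp)),
      pd_mul (contDiff_radial hd).diffble (contDiff_const.mul (contDiff_coord i)).diffble,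
      pd_const_mul (contDiff_coord i).diffble, pd_coord, pd_radial (hd.differentiable (by simp))]
    ring
  simp only [this]
  rw [Finset.sum_add_distrib, ← Finset.sum_mul, ← Finset.mul_sum, ← EuclideanSpace.real_norm_sq_eq]
  simp
  ring

/-- A smooth profile which agrees with the logarithm for `s ≥ 1`. -/
def logProfile (s : ℝ) : ℝ := Real.smoothTransition (2 * s - 1) * Real.log s

lemma contDiff_logProfile : ContDiff ℝ (⊤ : ℕ∞) logProfile := by
  rw [contDiff_iff_contDiffAt]
  intro s
  by_cases hs : s < 1 / 2
  · have : logProfile =ᶠ[nhds s] fun _ => 0 := by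
      filter_upwards [gt_mem_nhds hs] with t ht
      rw [logProfile, Real.smoothTransition.zero_of_nonpos (by linarith), zero_mul]
    exact contDiffAt_const.congr_of_eventuallyEq this
  · refine ContDiffAt.mul ?_ (Real.contDiffAt_log.2 (by linarith))
    exact (Real.smoothTransition.contDiff.comp
      ((contDiff_const.mul contDiff_id).sub contDiff_const)).contDiffAt

lemma logProfile_of_one_le {s : ℝ} (hs : 1 ≤ s) : logProfile s = Real.log s := by
  rw [logProfile, Real.smoothTransition.one_of_one_le (by linarith), one_mul]

lemma eqOn_deriv_Ioi {f g : ℝ → ℝ} {a : ℝ} (h : Set.EqOn f g (Set.Ioi a)) :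
    Set.EqOn (deriv f) (deriv g) (Set.Ioi a) := h.deriv isOpen_Ioi

lemma radialLap_logProfile : Set.EqOn (radialLap logProfile) (fun s => 4 * s⁻¹) (Set.Ioi 1) := by
  have h1 : Set.EqOn (deriv logProfile) (fun s => s⁻¹) (Set.Ioi 1) := by
    refine (eqOn_deriv_Ioi fun s hs => logProfile_of_one_le (le_of_lt hs)).trans fun s _ => ?_
    simp
  have h2 := eqOn_deriv_Ioi h1
  intro s hs
  have h0 : s ≠ 0 := by have : (1 : ℝ) < s := hs; linarith
  rw [radialLap, h2 hs, h1 hs]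
  simp only [deriv_inv']
  field_simp
  norm_num

lemma deriv_radialLap_logProfile :
    Set.EqOn (deriv (radialLap logProfile)) (fun s => -4 * (s ^ 2)⁻¹) (Set.Ioi 1) := by
  refine (eqOn_deriv_Ioi radialLap_logProfile).trans fun s hs => ?_
  simp

lemma radialLap_radialLap_logProfile :
    Set.EqOn (radialLap (radialLap logProfile)) (fun _ => 0) (Set.Ioi 1) := by
  have h2 := eqOn_deriv_Ioi deriv_radialLap_logProfile
  intro s hs
  have h0 : s ≠ 0 := by have : (1 : ℝ) < s := hs; linarith
  have h3 : HasDerivAt (fun s : ℝ => -4 * (s ^ 2)⁻¹) (-4 * (-(2 * s) / (s ^ 2) ^ 2)) s := by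
    have := ((hasDerivAt_pow 2 s).fun_inv (pow_ne_zero 2 h0)).const_mul (-4)
    simpa using this
  rw [radialLap, h2 hs, deriv_radialLap_logProfile hs, h3.deriv]
  field_simp
  ring

lemma integral_radialLap_radialLap_logProfile :
    ∫ x : E4, radialLap (radialLap logProfile) (‖x‖ ^ 2) ≠ 0 := by
  set β := radialLap logProfile with hβ
  have hβs : ContDiff ℝ (⊤ : ℕ∞) β := contDiff_logProfile.radialLap
  have hball : 0 < (volume : Measure E4).real (ball (0 : E4) 1) :=
    ENNReal.toReal_pos (measure_ball_pos _ _ one_pos).ne' measure_ball_lt_top.ne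
  have hder : ∀ r : ℝ, HasDerivAt (fun r => 2 * r ^ 4 * deriv β (r ^ 2))
      (r ^ 3 * radialLap β (r ^ 2)) r := by
    intro r
    have h1 : HasDerivAt (fun r : ℝ => 2 * r ^ 4) (2 * (4 * r ^ 3)) r := by
      simpa using (hasDerivAt_pow 4 r).const_mul 2
    have h2 : HasDerivAt (fun r : ℝ => deriv β (r ^ 2)) (deriv (deriv β) (r ^ 2) * (2 * r)) r := by
      have := ((hβs.deriv_top.differentiable (by simp)) (r ^ 2)).hasDerivAt.comp r
        (hasDerivAt_pow 2 r)
      simpa [Function.comp_def] using this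
    refine (h1.fun_mul h2).congr_deriv ?_
    unfold radialLap
    ring
  have hcont : Continuous fun r : ℝ => r ^ 3 * radialLap β (r ^ 2) :=
    (continuous_pow 3).mul (hβs.radialLap.continuous.comp (continuous_pow 2))
  have hzero : ∀ r : ℝ, 1 < r → r ^ 3 * radialLap β (r ^ 2) = 0 := by
    intro r hr
    rw [radialLap_radialLap_logProfile (show (1 : ℝ) < r ^ 2 by nlinarith), mul_zero]
  have hint : IntegrableOn (fun r : ℝ => r ^ 3 * radialLap β (r ^ 2)) (Set.Ioi 0) := by
    rw [← Set.Ioc_union_Ioi_eq_Ioi (zero_le_one' ℝ)]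
    refine IntegrableOn.union (hcont.integrableOn_Ioc) ?_
    exact integrableOn_zero.congr_fun (fun r hr => (hzero r hr).symm) measurableSet_Ioi
  have htend : Filter.Tendsto (fun r : ℝ => 2 * r ^ 4 * deriv β (r ^ 2)) Filter.atTop
      (nhds (-8)) := by
    refine tendsto_const_nhds.congr' ?_
    filter_upwards [Filter.eventually_gt_atTop 1] with r hr
    rw [deriv_radialLap_logProfile (show (1 : ℝ) < r ^ 2 by nlinarith)]
    have : r ≠ 0 := by linarith
    field_simp
    norm_num
  have key := integral_Ioi_of_hasDerivAt_of_tendsto (a := 0)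
    (hder 0).continuousAt.continuousWithinAt (fun r _ => hder r) hint htend
  have hdim : Module.finrank ℝ E4 = 4 := by simp
  rw [integral_fun_norm_addHaar volume (fun r : ℝ => radialLap β (r ^ 2)), hdim]
  simp only [smul_eq_mul, nsmul_eq_mul]
  rw [show (4 - 1 : ℕ) = 3 from rfl, key]
  norm_num
  exact hball.ne'

lemma hasCompactSupport_of_norm {f : E4 → ℝ} (h : ∀ x, 1 < ‖x‖ → f x = 0) :
    HasCompactSupport f := by
  refine HasCompactSupport.intro (isCompact_closedBall (0 : E4) 1) fun x hx => h x ?_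
  simpa using hx

/-- A mollifier `ρ` whose difference with its half-scale dilate is the bi-Laplacian of a test
function. -/
lemma exists_kernel : ∃ ρ ψ : E4 → ℝ, TestFun ρ ∧ TestFun ψ ∧ (∀ x, 1 < ‖x‖ → ρ x = 0) ∧
    (∀ x, 1 < ‖x‖ → ψ x = 0) ∧ ∫ x, ρ x = 1 ∧
    ∀ x, lapl (lapl ψ) x = ρ x - 16 * ρ ((2 : ℝ) • x) := by
  set Γ : E4 → ℝ := fun x => logProfile (‖x‖ ^ 2) with hΓ
  set ρ₀ : E4 → ℝ := fun x => radialLap (radialLap logProfile) (‖x‖ ^ 2) with hρ₀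
  have hΓs : ContDiff ℝ (⊤ : ℕ∞) Γ := contDiff_radial contDiff_logProfile
  have hlap : lapl (lapl Γ) = ρ₀ := by
    rw [hΓ, lapl_radial contDiff_logProfile, lapl_radial contDiff_logProfile.radialLap]
  set κ := ∫ x, ρ₀ x with hκ
  have hκ0 : κ ≠ 0 := integral_radialLap_radialLap_logProfile
  have hz : ∀ x : E4, 1 < ‖x‖ → ρ₀ x = 0 := fun x hx =>
    radialLap_radialLap_logProfile (show (1 : ℝ) < ‖x‖ ^ 2 by nlinarith)
  have hψz : ∀ x : E4, 1 < ‖x‖ → Γ x - dil (1 / 2) Γ x + Real.log 4 = 0 := by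
    intro x hx
    have h1 : (1 : ℝ) ≤ ‖x‖ ^ 2 := by nlinarith
    have h2 : ‖((1 / 2 : ℝ)⁻¹ • x)‖ ^ 2 = 4 * ‖x‖ ^ 2 := by
      rw [norm_smul]; norm_num; ring
    simp only [hΓ, dil]
    rw [h2, logProfile_of_one_le h1, logProfile_of_one_le (by linarith),
      Real.log_mul (by norm_num) (by linarith)]
    ring
  have hρs : TestFun ρ₀ := ⟨contDiff_radial contDiff_logProfile.radialLap.radialLap,
    hasCompactSupport_of_norm hz⟩
  have hψs : TestFun fun x => Γ x - dil (1 / 2) Γ x + Real.log 4 :=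
    ⟨(hΓs.sub (hΓs.dil _)).add contDiff_const, hasCompactSupport_of_norm hψz⟩
  refine ⟨fun x => κ⁻¹ * ρ₀ x, fun x => κ⁻¹ * (Γ x - dil (1 / 2) Γ x + Real.log 4),
    hρs.const_mul _, hψs.const_mul _, fun x hx => by simp only [hz x hx, mul_zero],
    fun x hx => by simp only [hψz x hx, mul_zero], ?_, fun x => ?_⟩
  · rw [integral_const_mul, ← hκ, inv_mul_cancel₀ hκ0]
  · rw [lapl_const_mul hψs.smooth, lapl_const_mul hψs.lapl.smooth]
    have e1 : ∀ (f g : E4 → ℝ) (c : ℝ), ContDiff ℝ (⊤ : ℕ∞) f → ContDiff ℝ (⊤ : ℕ∞) g →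
        lapl (fun x => f x - g x + c) = fun x => lapl f x - lapl g x := by
      intro f g c hf hg
      ext x
      simp only [lapl, ← Finset.sum_sub_distrib]
      refine Finset.sum_congr rfl fun i _ => ?_
      have : pd i (fun x => f x - g x + c) = fun x => pd i f x - pd i g x := by
        rw [← pd_sub hf.diffble hg.diffble]
        ext x
        unfold pd
        rw [fderiv_add_const]
      rw [this, pd_sub (hf.pd i).diffble (hg.pd i).diffble]
    have e2 := e1 _ _ 0 hΓs.lapl (hΓs.dil (1 / 2)).lapl
    simp only [add_zero] at e2
    rw [e1 Γ _ _ hΓs (hΓs.dil _), e2, hlap, bilapl_dil _ hΓs, hlap]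
    simp only [dil]
    norm_num
    ring

/-- The unscaled mollifier. -/
def rho : E4 → ℝ := exists_kernel.choose

/-- The test function whose bi-Laplacian is a difference of two mollifiers. -/
def psi : E4 → ℝ := exists_kernel.choose_spec.choose

lemma testFun_rho : TestFun rho := exists_kernel.choose_spec.choose_spec.1

lemma testFun_psi : TestFun psi := exists_kernel.choose_spec.choose_spec.2.1

lemma rho_eq_zero {x : E4} (hx : 1 < ‖x‖) : rho x = 0 :=
  exists_kernel.choose_spec.choose_spec.2.2.1 x hx

lemma psi_eq_zero {x : E4} (hx : 1 < ‖x‖) : psi x = 0 :=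
  exists_kernel.choose_spec.choose_spec.2.2.2.1 x hx

lemma integral_rho : ∫ x, rho x = 1 := exists_kernel.choose_spec.choose_spec.2.2.2.2.1

lemma bilapl_psi (x : E4) : lapl (lapl psi) x = rho x - 16 * rho ((2 : ℝ) • x) :=
  exists_kernel.choose_spec.choose_spec.2.2.2.2.2 x

/-- The mollifier at scale `s`. -/
def rhoS (s : ℝ) (x : E4) : ℝ := (s⁻¹) ^ 4 * dil s rho x

lemma testFun_rhoS {s : ℝ} (hs : 0 < s) : TestFun (rhoS s) :=
  (testFun_rho.dil hs.ne').const_mul _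

lemma testFun_psiS {s : ℝ} (hs : 0 < s) : TestFun (dil s psi) := testFun_psi.dil hs.ne'

lemma pd_eq_zero_of_norm {f : E4 → ℝ} {r : ℝ} (hf : ∀ z, r < ‖z‖ → f z = 0) (i : Fin 4) (z : E4)
    (hz : r < ‖z‖) : pd i f z = 0 := by
  have : f =ᶠ[nhds z] fun _ => 0 := by
    filter_upwards [continuous_norm.continuousAt.eventually (lt_mem_nhds hz)] with y hy
    exact hf y hy
  unfold pd
  rw [this.fderiv_eq]
  simp

lemma pds_eq_zero_of_norm {f : E4 → ℝ} {r : ℝ} (hf : ∀ z, r < ‖z‖ → f z = 0)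
    (l : List (Fin 4)) (z : E4) (hz : r < ‖z‖) : pds l f z = 0 := by
  induction l generalizing z with
  | nil => exact hf z hz
  | cons i l ih => exact pd_eq_zero_of_norm ih i z hz

lemma one_lt_norm_inv_smul {s : ℝ} (hs : 0 < s) {z : E4} (hz : s < ‖z‖) : 1 < ‖s⁻¹ • z‖ := by
  rw [norm_smul, norm_inv, Real.norm_of_nonneg hs.le, inv_mul_eq_div, one_lt_div hs]
  exact hz

lemma rhoS_eq_zero {s : ℝ} (hs : 0 < s) (z : E4) (hz : s < ‖z‖) : rhoS s z = 0 := by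
  rw [rhoS, dil, rho_eq_zero (one_lt_norm_inv_smul hs hz), mul_zero]

lemma psiS_eq_zero {s : ℝ} (hs : 0 < s) (z : E4) (hz : s < ‖z‖) : dil s psi z = 0 :=
  psi_eq_zero (one_lt_norm_inv_smul hs hz)

lemma integral_rhoS {s : ℝ} (hs : 0 < s) : ∫ x, rhoS s x = 1 := by
  unfold rhoS dil
  rw [integral_const_mul, Measure.integral_comp_inv_smul, integral_rho]
  simp only [finrank_euclideanSpace, Fintype.card_fin, abs_of_pos (pow_pos hs 4), smul_eq_mul,
    mul_one]
  rw [← mul_pow, inv_mul_cancel₀ hs.ne', one_pow]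

lemma bilapl_psiS {s : ℝ} (hs : 0 < s) :
    lapl (lapl (dil s psi)) = fun x => rhoS s x - rhoS (s / 2) x := by
  rw [bilapl_dil s testFun_psi.smooth]
  ext x
  simp only [dil, rhoS, bilapl_psi, smul_smul, inv_div, div_eq_mul_inv (2 : ℝ)]
  field_simp
  ring

/-- Pointwise and Lipschitz bounds for derivatives of order at most four of a test function and
of its dilates. -/
lemma TestFun.exists_dil_bound {f : E4 → ℝ} (hf : TestFun f) : ∃ A, 0 < A ∧
    ∀ l : List (Fin 4), l.length ≤ 4 → ∀ s : ℝ, 0 < s →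
      (∀ z, |_root_.pds l (_root_.dil s f) z| ≤ A * s⁻¹ ^ l.length) ∧
      ∀ z w, |_root_.pds l (_root_.dil s f) z - _root_.pds l (_root_.dil s f) w| ≤
        A * s⁻¹ ^ (l.length + 1) * ‖z - w‖ := by
  have h1 : ∀ l : List (Fin 4), ∃ B, 0 < B ∧ (∀ x, |_root_.pds l f x| ≤ B) ∧
      ∀ x y, |_root_.pds l f x - _root_.pds l f y| ≤ B * ‖x - y‖ := by
    intro l
    obtain ⟨B, hB, h⟩ := (hf.pds l).bounded
    obtain ⟨D, hD, h'⟩ := (hf.pds l).lipschitz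
    refine ⟨B + D, by positivity, fun x => (h x).trans (by linarith), fun x y => (h' x y).trans ?_⟩
    gcongr
    linarith
  choose B hB hb hl using h1
  obtain ⟨A, hA⟩ := ((List.finite_length_le (Fin 4) 4).image B).bddAbove
  refine ⟨max A 1, by positivity, fun l hlen s hs => ?_⟩
  have hBA : B l ≤ max A 1 := (hA ⟨l, hlen, rfl⟩).trans (le_max_left _ _)
  have hs' : 0 < s⁻¹ := inv_pos.2 hs
  rw [pds_dil s hf.smooth]
  refine ⟨fun z => ?_, fun z w => ?_⟩
  · rw [abs_mul, abs_of_pos (pow_pos hs' _), mul_comm]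
    gcongr
    exact (hb l _).trans hBA
  · rw [← mul_sub, abs_mul, abs_of_pos (pow_pos hs' _)]
    calc _ ≤ s⁻¹ ^ l.length * (B l * ‖s⁻¹ • z - s⁻¹ • w‖) := by
          gcongr; exact hl l _ _
      _ ≤ s⁻¹ ^ l.length * (max A 1 * ‖s⁻¹ • z - s⁻¹ • w‖) := by gcongr
      _ = _ := by rw [← smul_sub, norm_smul, Real.norm_of_nonneg hs'.le]; ring

lemma exists_kernel_bound : ∃ A, 0 < A ∧ ∀ l : List (Fin 4), l.length ≤ 4 → ∀ s : ℝ, 0 < s →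
    (∀ z, |pds l (dil s psi) z| ≤ A * s⁻¹ ^ l.length) ∧
    (∀ z w, |pds l (dil s psi) z - pds l (dil s psi) w| ≤ A * s⁻¹ ^ (l.length + 1) * ‖z - w‖) ∧
    (∀ z, |pds l (rhoS s) z| ≤ A * s⁻¹ ^ (l.length + 4)) ∧
    ∀ z w, |pds l (rhoS s) z - pds l (rhoS s) w| ≤ A * s⁻¹ ^ (l.length + 5) * ‖z - w‖ := by
  obtain ⟨A, hA, h⟩ := testFun_psi.exists_dil_bound
  obtain ⟨B, hB, h'⟩ := testFun_rho.exists_dil_bound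
  have key : ∀ (s : ℝ) (l : List (Fin 4)),
      pds l (rhoS s) = fun x => s⁻¹ ^ 4 * pds l (dil s rho) x := by
    intro s l
    induction l with
    | nil => rfl
    | cons i l ih =>
      simp only [pds]
      rw [ih, pd_const_mul ((testFun_rho.smooth.dil s).pds l).diffble]
  refine ⟨A + B, by positivity, fun l hl s hs => ?_⟩
  have hs' : 0 < s⁻¹ := inv_pos.2 hs
  obtain ⟨h1, h2⟩ := h l hl s hs
  obtain ⟨h3, h4⟩ := h' l hl s hs
  refine ⟨fun z => (h1 z).trans ?_, fun z w => (h2 z w).trans ?_, fun z => ?_, fun z w => ?_⟩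
  · gcongr; linarith
  · gcongr; linarith
  · rw [key, abs_mul, abs_of_pos (pow_pos hs' _)]
    calc _ ≤ s⁻¹ ^ 4 * (B * s⁻¹ ^ l.length) := by gcongr; exact h3 z
      _ ≤ s⁻¹ ^ 4 * ((A + B) * s⁻¹ ^ l.length) := by gcongr; linarith
      _ = _ := by ring
  · rw [key, ← mul_sub, abs_mul, abs_of_pos (pow_pos hs' _)]
    calc _ ≤ s⁻¹ ^ 4 * (B * s⁻¹ ^ (l.length + 1) * ‖z - w‖) := by gcongr; exact h4 z w
      _ ≤ s⁻¹ ^ 4 * ((A + B) * s⁻¹ ^ (l.length + 1) * ‖z - w‖) := by gcongr; linarith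
      _ = _ := by ring

/-- A constant controlling all the kernels. -/
def kerC : ℝ := exists_kernel_bound.choose

lemma kerC_pos : 0 < kerC := exists_kernel_bound.choose_spec.1

lemma abs_pds_psiS_le {l : List (Fin 4)} (hl : l.length ≤ 4) {s : ℝ} (hs : 0 < s) (z : E4) :
    |pds l (dil s psi) z| ≤ kerC * s⁻¹ ^ l.length :=
  (exists_kernel_bound.choose_spec.2 l hl s hs).1 z

lemma abs_pds_psiS_sub_le {l : List (Fin 4)} (hl : l.length ≤ 4) {s : ℝ} (hs : 0 < s) (z w : E4) :
    |pds l (dil s psi) z - pds l (dil s psi) w| ≤ kerC * s⁻¹ ^ (l.length + 1) * ‖z - w‖ :=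
  (exists_kernel_bound.choose_spec.2 l hl s hs).2.1 z w

lemma abs_pds_rhoS_le {l : List (Fin 4)} (hl : l.length ≤ 4) {s : ℝ} (hs : 0 < s) (z : E4) :
    |pds l (rhoS s) z| ≤ kerC * s⁻¹ ^ (l.length + 4) :=
  (exists_kernel_bound.choose_spec.2 l hl s hs).2.2.1 z

lemma abs_pds_rhoS_sub_le {l : List (Fin 4)} (hl : l.length ≤ 4) {s : ℝ} (hs : 0 < s) (z w : E4) :
    |pds l (rhoS s) z - pds l (rhoS s) w| ≤ kerC * s⁻¹ ^ (l.length + 5) * ‖z - w‖ :=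
  (exists_kernel_bound.choose_spec.2 l hl s hs).2.2.2 z w

lemma abs_cv_rhoS_le {f : E4 → ℝ} {x : E4} {s M : ℝ} (hs : 0 < s)
    (hf : IntegrableOn f (closedBall x s)) (hfM : ∀ y ∈ closedBall x s, |f y| ≤ M) :
    |cv f (rhoS s) x| ≤ kerC * ballVol * M := by
  refine (abs_cv_le_of_bound hs.le (rhoS_eq_zero hs)
    (abs_pds_rhoS_le (l := []) (by simp) hs) hf hfM).trans_eq ?_
  simp only [List.length_nil, zero_add]
  field_simp

/-- Approximate identity. -/
lemma abs_cv_rhoS_sub_le {g : E4 → ℝ} (hg : TestFun g) {L s : ℝ} (hs : 0 < s)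
    (hL : ∀ x y, |g x - g y| ≤ L * ‖x - y‖) (hL0 : 0 ≤ L) (x : E4) :
    |cv g (rhoS s) x - g x| ≤ kerC * ballVol * (L * s) := by
  have h1 : cv g (rhoS s) x - g x = cv (fun y => g y - g x) (rhoS s) x := by
    have : g x = ∫ y, g x * rhoS s (x - y) := by
      rw [integral_const_mul, integral_sub_left_eq_self (rhoS s) volume x, integral_rhoS hs,
        mul_one]
    unfold cv
    conv_lhs => rw [this]
    rw [← integral_sub (cv_integrand_integrable hg.integrable.locallyIntegrable
      (testFun_rhoS hs) x) (cv_integrand_integrable (locallyIntegrable_const _)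
      (testFun_rhoS hs) x)]
    simp only [sub_mul]
  rw [h1]
  refine abs_cv_rhoS_le hs ?_ fun y hy => (hL y x).trans ?_
  · exact (hg.continuous.sub continuous_const).locallyIntegrable.integrableOn_isCompact
      (isCompact_closedBall _ _)
  · gcongr
    exact mem_closedBall_iff_norm.1 hy

lemma cv_pds_comm {u g : E4 → ℝ} (hu : TestFun u) (hg : TestFun g) (l : List (Fin 4)) :
    cv (pds l u) g = cv u (pds l g) := by
  rw [← pds_cv_left hu hg, pds_cv_right hu.integrable.locallyIntegrable hg]

lemma cv_telescope {u : E4 → ℝ} (hu : TestFun u) (l : List (Fin 4)) {s : ℝ} (hs : 0 < s)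
    (N : ℕ) (x : E4) :
    cv u (pds l (rhoS s)) x - cv (pds l u) (rhoS (s / 2 ^ N)) x =
      ∑ k ∈ Finset.range N, cv (lapl (lapl u)) (pds l (dil (s / 2 ^ k) psi)) x := by
  induction N with
  | zero => simp [cv_pds_comm hu (testFun_rhoS hs)]
  | succ N ih =>
    have hsN : 0 < s / 2 ^ N := by positivity
    rw [Finset.sum_range_succ, ← ih, ← cv_pds_bilapl hu (testFun_psiS hsN), bilapl_psiS hsN,
      cv_sub (hu.pds l).integrable.locallyIntegrable (testFun_rhoS hsN)
        (testFun_rhoS (by positivity)), pow_succ, div_mul_eq_div_div]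
    ring

lemma exists_approx {g : E4 → ℝ} (hg : TestFun g) {s ε : ℝ} (hs : 0 < s) (hε : 0 < ε) (m : ℕ) :
    ∃ N, m ≤ N ∧ ∀ x, |cv g (rhoS (s / 2 ^ N)) x - g x| ≤ ε := by
  obtain ⟨L, hL, h⟩ := hg.lipschitz
  have ht : Filter.Tendsto (fun N : ℕ => kerC * ballVol * (L * (s / 2 ^ N))) Filter.atTop
      (nhds 0) := by
    have := (tendsto_pow_atTop_nhds_zero_of_lt_one (r := (1 / 2 : ℝ)) (by norm_num)
      (by norm_num)).const_mul (kerC * ballVol * (L * s))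
    rw [mul_zero] at this
    refine this.congr fun N => ?_
    rw [one_div, inv_pow]
    ring
  obtain ⟨N, hN⟩ := ((ht.eventually (gt_mem_nhds hε)).and (Filter.eventually_ge_atTop m)).exists
  exact ⟨N, hN.2, fun x => (abs_cv_rhoS_sub_le hg (by positivity) h hL.le x).trans hN.1.le⟩

lemma sum_half_pow_le (N : ℕ) : ∑ k ∈ Finset.range N, (1 / 2 : ℝ) ^ k ≤ 2 :=
  sum_geometric_two_le N

/-- Interior estimate for derivatives of order at most three. -/
lemma abs_pds_le {u : E4 → ℝ} (hu : TestFun u) {l : List (Fin 4)} (hl : l.length ≤ 3) {s M : ℝ}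
    (hs : 0 < s) {x : E4} (hM : ∀ y ∈ closedBall x s, |lapl (lapl u) y| ≤ M) :
    s ^ l.length * |pds l u x| ≤ kerC * s⁻¹ ^ 4 * (∫ y in closedBall x s, |u y|) +
      2 * kerC * ballVol * (s ^ 4 * M) := by
  have hb := ballVol_nonneg
  have hk := kerC_pos
  have hM0 : 0 ≤ M := (abs_nonneg _).trans (hM x (mem_closedBall_self hs.le))
  refine le_of_forall_pos_le_add fun ε hε => ?_
  have hε' : 0 < ε / s ^ l.length := by positivity
  obtain ⟨N, -, hN⟩ := exists_approx (hu.pds l) hs hε' 0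
  have h1 : |cv u (pds l (rhoS s)) x| ≤
      kerC * s⁻¹ ^ (l.length + 4) * ∫ y in closedBall x s, |u y| :=
    abs_cv_le (pds_eq_zero_of_norm (rhoS_eq_zero hs) l) (abs_pds_rhoS_le (by omega) hs)
      hu.integrable.integrableOn
  have h2 : ∀ k ∈ Finset.range N,
      s ^ l.length * |cv (lapl (lapl u)) (pds l (dil (s / 2 ^ k) psi)) x| ≤
      kerC * ballVol * (s ^ 4 * M) * (1 / 2) ^ k := by
    intro k _
    have hsk : 0 < s / 2 ^ k := by positivity
    have hle : s / 2 ^ k ≤ s := div_le_self hs.le (one_le_pow₀ (by norm_num))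
    have := abs_cv_le_of_bound (f := lapl (lapl u)) (x := x) hsk.le
      (pds_eq_zero_of_norm (psiS_eq_zero hsk) l) (abs_pds_psiS_le (l := l) (by omega) hsk)
      hu.lapl.lapl.integrable.integrableOn
      (fun y hy => hM y (closedBall_subset_closedBall hle hy))
    calc _ ≤ s ^ l.length *
          (kerC * (s / 2 ^ k)⁻¹ ^ l.length * (M * ((s / 2 ^ k) ^ 4 * ballVol))) := by
          gcongr
      _ = kerC * ballVol * (s ^ 4 * M) * ((1 / 2) ^ k) ^ (4 - l.length) := by
          have e : ((1 / 2 : ℝ) ^ k) ^ 4 =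
              ((1 / 2) ^ k) ^ (4 - l.length) * ((1 / 2) ^ k) ^ l.length := by
            rw [← pow_add]; congr 1; omega
          have e2 : s / 2 ^ k = s * (1 / 2) ^ k := by rw [one_div, inv_pow]; ring
          rw [e2, mul_pow s, e, inv_pow, mul_pow]
          field_simp
      _ ≤ kerC * ballVol * (s ^ 4 * M) * (1 / 2) ^ k := by
          gcongr
          refine pow_le_of_le_one (by positivity) (pow_le_one₀ (by norm_num) (by norm_num))
            (by omega)
  have h3 : s ^ l.length * |∑ k ∈ Finset.range N,
      cv (lapl (lapl u)) (pds l (dil (s / 2 ^ k) psi)) x| ≤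
      2 * kerC * ballVol * (s ^ 4 * M) := by
    calc _ ≤ s ^ l.length * ∑ k ∈ Finset.range N,
          |cv (lapl (lapl u)) (pds l (dil (s / 2 ^ k) psi)) x| := by
          gcongr; exact Finset.abs_sum_le_sum_abs _ _
      _ ≤ ∑ k ∈ Finset.range N, kerC * ballVol * (s ^ 4 * M) * (1 / 2) ^ k := by
          rw [Finset.mul_sum]; exact Finset.sum_le_sum h2
      _ ≤ kerC * ballVol * (s ^ 4 * M) * 2 := by
          rw [← Finset.mul_sum]; gcongr; exact sum_half_pow_le N
      _ = _ := by ring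
  have h4 := cv_telescope hu l hs N x
  have h5 : |pds l u x| ≤ |cv u (pds l (rhoS s)) x| + |∑ k ∈ Finset.range N,
      cv (lapl (lapl u)) (pds l (dil (s / 2 ^ k) psi)) x| + ε / s ^ l.length := by
    have := hN x
    rw [← h4]
    have e : pds l u x = cv u (pds l (rhoS s)) x -
      (cv u (pds l (rhoS s)) x - cv (pds l u) (rhoS (s / 2 ^ N)) x) -
      (cv (pds l u) (rhoS (s / 2 ^ N)) x - pds l u x) := by ring
    conv_lhs => rw [e]
    exact (abs_sub _ _).trans (add_le_add (abs_sub _ _) this)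
  calc s ^ l.length * |pds l u x| ≤ s ^ l.length * (|cv u (pds l (rhoS s)) x| +
      |∑ k ∈ Finset.range N, cv (lapl (lapl u)) (pds l (dil (s / 2 ^ k) psi)) x| +
        ε / s ^ l.length) := by gcongr
    _ = s ^ l.length * |cv u (pds l (rhoS s)) x| + s ^ l.length *
      |∑ k ∈ Finset.range N, cv (lapl (lapl u)) (pds l (dil (s / 2 ^ k) psi)) x| + ε := by
        field_simp
    _ ≤ s ^ l.length * (kerC * s⁻¹ ^ (l.length + 4) * ∫ y in closedBall x s, |u y|) +
        2 * kerC * ballVol * (s ^ 4 * M) + ε := by gcongr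
    _ = _ := by
        rw [pow_add, inv_pow s l.length]
        field_simp

lemma cv_eq_zero {f K : E4 → ℝ} {x x₁ : E4} {a r : ℝ} (hK : ∀ z, r < ‖z‖ → K z = 0)
    (hf : ∀ y, a < ‖y - x₁‖ → f y = 0) (hx : a + r < ‖x - x₁‖) : cv f K x = 0 := by
  unfold cv
  rw [integral_eq_zero_of_ae]
  refine Filter.Eventually.of_forall fun y => ?_
  by_cases hy : a < ‖y - x₁‖
  · simp [hf y hy]
  · have h1 : r < ‖x - y‖ := by
      have := norm_add_le (x - y) (y - x₁)
      rw [sub_add_sub_cancel] at this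
      linarith
    simp [hK _ h1]

/-- A convolution only depends on the values of the function near the point. -/
lemma cv_congr_left {f f' K : E4 → ℝ} {x : E4} {r : ℝ} (hK : ∀ z, r < ‖z‖ → K z = 0)
    (hf : ∀ y ∈ closedBall x r, f y = f' y) : cv f K x = cv f' K x := by
  unfold cv
  refine integral_congr_ae (Filter.Eventually.of_forall fun y => ?_)
  by_cases hy : y ∈ closedBall x r
  · simp only [hf y hy]
  · have : r < ‖x - y‖ := by rwa [mem_closedBall_iff_norm', not_le] at hy
    simp [hK _ this]

/-- Square integral estimate for fourth derivatives of the truncated potential. -/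
lemma integral_sq_cv_le {F : E4 → ℝ} (hF : TestFun F) {l : List (Fin 4)} (hl : l.length = 4)
    {r M : ℝ} (hr : 0 < r) (n : ℕ) {x₁ : E4} (hM : ∀ y ∈ closedBall x₁ (4 * r), |F y| ≤ M) :
    ∫ x in closedBall x₁ r, (∑ k ∈ Finset.range n, cv F (pds l (dil (r / 2 ^ k) psi)) x) ^ 2 ≤
      (2 * kerC * ballVol) ^ 2 * 256 * ballVol * M ^ 2 * r ^ 4 := by
  have hb := ballVol_nonneg
  have hk := kerC_pos
  have hM0 : 0 ≤ M := (abs_nonneg _).trans (hM x₁ (mem_closedBall_self (by positivity)))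
  have hrk : ∀ k : ℕ, 0 < r / 2 ^ k := fun k => by positivity
  have hrle : ∀ k : ℕ, r / 2 ^ k ≤ r := fun k => div_le_self hr.le (one_le_pow₀ (by norm_num))
  let χ : ContDiffBump x₁ := ⟨2 * r, 3 * r, by positivity, by linarith⟩
  set f : E4 → ℝ := fun x => χ x * F x with hfdef
  have hf : TestFun f := hF.mul_left χ.contDiff
  have hf0 : ∀ y, 3 * r < ‖y - x₁‖ → f y = 0 := by
    intro y hy
    rw [hfdef]
    simp only
    rw [χ.zero_of_le_dist (by rw [dist_eq_norm]; exact hy.le), zero_mul]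
  have hf1 : ∀ y ∈ closedBall x₁ (2 * r), F y = f y := by
    intro y hy
    rw [hfdef]
    simp only
    rw [χ.one_of_mem_closedBall hy, one_mul]
  have hfM : ∀ y, |f y| ≤ M := by
    intro y
    by_cases hy : y ∈ closedBall x₁ (4 * r)
    · rw [hfdef]
      simp only
      rw [abs_mul, abs_of_nonneg χ.nonneg]
      exact (mul_le_of_le_one_left (abs_nonneg _) χ.le_one).trans (hM y hy)
    · rw [hf0 y ?_, abs_zero]
      · exact hM0
      · rw [mem_closedBall_iff_norm, not_le] at hy
        linarith
  set w : E4 → ℝ := fun x => ∑ k ∈ Finset.range n, cv f (dil (r / 2 ^ k) psi) x with hw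
  have hwT : TestFun w := TestFun.sum _ fun k _ => hf.cv (testFun_psiS (hrk k))
  have e1 : ∀ x ∈ closedBall x₁ r,
      (∑ k ∈ Finset.range n, cv F (pds l (dil (r / 2 ^ k) psi)) x) = pds l w x := by
    intro x hx
    rw [hw, pds_sum _ fun k _ => (hf.cv (testFun_psiS (hrk k))).smooth]
    refine Finset.sum_congr rfl fun k _ => ?_
    rw [pds_cv_right hf.integrable.locallyIntegrable (testFun_psiS (hrk k))]
    refine cv_congr_left (pds_eq_zero_of_norm (psiS_eq_zero (hrk k)) l) fun y hy => hf1 y ?_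
    rw [mem_closedBall] at hx hy ⊢
    linarith [dist_triangle y x x₁, hrle k]
  have e2 : ∀ x, lapl (lapl w) x = cv f (rhoS r) x - cv f (rhoS (r / 2 ^ n)) x := by
    intro x
    have : lapl (lapl w) = fun x =>
        ∑ k ∈ Finset.range n, cv (lapl (lapl f)) (dil (r / 2 ^ k) psi) x := by
      have hs : ∀ G : ℕ → E4 → ℝ, (∀ k, TestFun (G k)) →
          lapl (fun x => ∑ k ∈ Finset.range n, G k x) =
            fun x => ∑ k ∈ Finset.range n, lapl (G k) x := by
        intro G hG
        ext x
        unfold lapl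
        rw [Finset.sum_comm]
        refine Finset.sum_congr rfl fun i _ => ?_
        rw [pd_sum _ fun k _ => (hG k).diffble, pd_sum _ fun k _ => ((hG k).pd i).diffble]
      rw [hw, hs _ fun k => hf.cv (testFun_psiS (hrk k)),
        hs _ fun k => (hf.cv (testFun_psiS (hrk k))).lapl]
      ext x
      refine Finset.sum_congr rfl fun k _ => ?_
      rw [lapl_cv_left hf (testFun_psiS (hrk k)), lapl_cv_left hf.lapl (testFun_psiS (hrk k))]
    rw [this]
    exact (cv_telescope hf [] hr n x).symm
  have e3 : ∀ x, |lapl (lapl w) x| ≤ 2 * kerC * ballVol * M := by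
    intro x
    rw [e2]
    have h1 := abs_cv_rhoS_le (x := x) hr hf.integrable.integrableOn fun y _ => hfM y
    have h2 := abs_cv_rhoS_le (x := x) (hrk n) hf.integrable.integrableOn fun y _ => hfM y
    exact (abs_sub _ _).trans (by linarith)
  have e4 : ∀ x, x ∉ closedBall x₁ (4 * r) → (lapl (lapl w) x) ^ 2 = 0 := by
    intro x hx
    rw [mem_closedBall_iff_norm, not_le] at hx
    rw [e2, cv_eq_zero (rhoS_eq_zero hr) hf0 (by linarith),
      cv_eq_zero (rhoS_eq_zero (hrk n)) hf0 (by linarith [hrle n])]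
    simp
  calc _ = ∫ x in closedBall x₁ r, (pds l w x) ^ 2 :=
        setIntegral_congr_fun measurableSet_closedBall fun x hx => by simp only [e1 x hx]
    _ ≤ ∫ x, (pds l w x) ^ 2 := by
        refine setIntegral_le_integral ?_ (Filter.Eventually.of_forall fun x => sq_nonneg _)
        simpa only [sq] using ((hwT.pds l).mul_left (hwT.pds l).smooth).integrable
    _ ≤ ∫ x, (lapl (lapl w) x) ^ 2 := integral_sq_pds_le hwT hl
    _ = ∫ x in closedBall x₁ (4 * r), (lapl (lapl w) x) ^ 2 :=
        (setIntegral_eq_integral_of_forall_compl_eq_zero e4).symm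
    _ ≤ (2 * kerC * ballVol * M) ^ 2 * volume.real (closedBall x₁ (4 * r)) := by
        refine (Real.le_norm_self _).trans ?_
        refine norm_setIntegral_le_of_norm_le_const measure_closedBall_lt_top fun x _ => ?_
        rw [Real.norm_of_nonneg (sq_nonneg _), ← sq_abs]
        gcongr
        exact e3 x
    _ = _ := by
        rw [volume_real_closedBall _ (by positivity)]
        ring

/-- Mean oscillation estimate for fourth derivatives. -/
lemma exists_oscillation_bound {s : ℝ} (hs : 0 < s) : ∃ C, 0 < C ∧
    ∀ u : E4 → ℝ, TestFun u → ∀ l : List (Fin 4), l.length = 4 → ∀ M, 0 < M → ∀ (x₁ : E4) (m : ℕ),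
    (∀ y ∈ closedBall x₁ (4 * s), |u y| ≤ M) →
    (∀ y ∈ closedBall x₁ (4 * s), |lapl (lapl u) y| ≤ M) →
    ∃ c, (m = 0 → |c| ≤ C * M) ∧
      ∫ x in closedBall x₁ (s / 2 ^ m), (pds l u x - c) ^ 2 ≤ C * M ^ 2 * (s / 2 ^ m) ^ 4 := by
  have hb := ballVol_nonneg
  have hk := kerC_pos
  set B := kerC * s⁻¹ ^ 9 * s * ((2 * s) ^ 4 * ballVol) + kerC * (16 * ballVol) + 1 with hB
  have hB0 : 0 < B := by positivity
  set D := (2 * kerC * ballVol) ^ 2 * 256 * ballVol with hD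
  refine ⟨kerC * s⁻¹ ^ 8 * (s ^ 4 * ballVol) + (2 * B ^ 2 * ballVol + 2 * D) + 1,
    by positivity, fun u hu l hl M hM x₁ m huM hFM => ?_⟩
  set F := lapl (lapl u) with hF
  have hFT : TestFun F := hu.lapl.lapl
  set r := s / 2 ^ m with hr
  have hr0 : 0 < r := by positivity
  have hrs : r ≤ s := div_le_self hs.le (one_le_pow₀ (by norm_num))
  obtain ⟨N, hmN, hN⟩ := exists_approx (hu.pds l) hs hM m
  obtain ⟨n, rfl⟩ := Nat.exists_eq_add_of_le hmN
  set T : ℕ → E4 → ℝ := fun k => cv F (pds l (dil (s / 2 ^ k) psi)) with hT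
  set P : E4 → ℝ := cv u (pds l (rhoS s)) with hP
  have hPc : |P x₁| ≤ kerC * s⁻¹ ^ 8 * (s ^ 4 * ballVol) * M := by
    have := abs_cv_le_of_bound (x := x₁) (M := M) hs.le (pds_eq_zero_of_norm (rhoS_eq_zero hs) l)
      (abs_pds_rhoS_le hl.le hs) hu.integrable.integrableOn
      (fun y hy => huM y (closedBall_subset_closedBall (by linarith) hy))
    rw [hl] at this
    exact this.trans_eq (by ring)
  have hosc1 : ∀ x ∈ closedBall x₁ r,
      |P x - P x₁| ≤ kerC * s⁻¹ ^ 9 * s * ((2 * s) ^ 4 * ballVol) * M := by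
    intro x hx
    rw [mem_closedBall_iff_norm] at hx
    have := abs_cv_sub_cv_le (x := x) (x₀ := x₁) (M := M) hs.le ((testFun_rhoS hs).pds l)
      hu.integrable.locallyIntegrable (pds_eq_zero_of_norm (rhoS_eq_zero hs) l)
      (abs_pds_rhoS_sub_le hl.le hs) (hx.trans hrs) (by positivity)
      (fun y hy => huM y (closedBall_subset_closedBall (by linarith) hy))
    rw [hl] at this
    refine this.trans ?_
    calc _ ≤ kerC * s⁻¹ ^ (4 + 5) * s * (M * ((2 * s) ^ 4 * ballVol)) := by
          gcongr; exact hx.trans hrs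
      _ = _ := by ring
  have hosc2 : ∀ x ∈ closedBall x₁ r, ∀ k ∈ Finset.range m,
      |T k x - T k x₁| ≤ kerC * (16 * ballVol) * M * (2 ^ k / 2 ^ m) := by
    intro x hx k hkm
    rw [mem_closedBall_iff_norm] at hx
    have hsk : 0 < s / 2 ^ k := by positivity
    have hsks : s / 2 ^ k ≤ s := div_le_self hs.le (one_le_pow₀ (by norm_num))
    have hrk : r ≤ s / 2 ^ k := by
      rw [hr]
      have := (Finset.mem_range.1 hkm).le
      gcongr
      norm_num
    have := abs_cv_sub_cv_le (x := x) (x₀ := x₁) (M := M) hsk.le ((testFun_psiS hsk).pds l)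
      hFT.integrable.locallyIntegrable (pds_eq_zero_of_norm (psiS_eq_zero hsk) l)
      (abs_pds_psiS_sub_le hl.le hsk) (hx.trans hrk) (by positivity)
      (fun y hy => hFM y (closedBall_subset_closedBall (by linarith) hy))
    rw [hl] at this
    refine this.trans ?_
    calc _ ≤ kerC * (s / 2 ^ k)⁻¹ ^ (4 + 1) * r * (M * ((2 * (s / 2 ^ k)) ^ 4 * ballVol)) := by
          gcongr
      _ = _ := by
          rw [hr, inv_div, div_pow]
          field_simp
          ring
  have hsum : ∑ k ∈ Finset.range m, (2 : ℝ) ^ k / 2 ^ m ≤ 1 := by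
    rw [← Finset.sum_div, div_le_one (by positivity), geom_sum_eq (by norm_num)]
    norm_num
  set c := P x₁ - ∑ k ∈ Finset.range m, T k x₁ with hc
  set S : E4 → ℝ := fun x => ∑ k ∈ Finset.range n, cv F (pds l (dil (r / 2 ^ k) psi)) x with hS
  have hpt : ∀ x ∈ closedBall x₁ r, (pds l u x - c) ^ 2 ≤ 2 * (B * M) ^ 2 + 2 * (S x) ^ 2 := by
    intro x hx
    have h1 := cv_telescope hu l hs (m + n) x
    rw [Finset.sum_range_add] at h1
    have h2 : ∑ k ∈ Finset.range n, cv F (pds l (dil (s / 2 ^ (m + k)) psi)) x = S x := by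
      refine Finset.sum_congr rfl fun k _ => ?_
      rw [pow_add, hr, div_div]
    rw [h2] at h1
    have h3 : |∑ k ∈ Finset.range m, T k x - ∑ k ∈ Finset.range m, T k x₁| ≤
        kerC * (16 * ballVol) * M := by
      rw [← Finset.sum_sub_distrib]
      calc _ ≤ ∑ k ∈ Finset.range m, kerC * (16 * ballVol) * M * (2 ^ k / 2 ^ m) :=
            (Finset.abs_sum_le_sum_abs _ _).trans (Finset.sum_le_sum (hosc2 x hx))
        _ ≤ kerC * (16 * ballVol) * M * 1 := by
            rw [← Finset.mul_sum]; gcongr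
        _ = _ := mul_one _
    have h4 : |pds l u x - c + S x| ≤ B * M := by
      have e : pds l u x - c + S x = (P x - P x₁) -
          (∑ k ∈ Finset.range m, T k x - ∑ k ∈ Finset.range m, T k x₁) -
          (cv (pds l u) (rhoS (s / 2 ^ (m + n))) x - pds l u x) := by
        have h1' : P x - cv (pds l u) (rhoS (s / 2 ^ (m + n))) x =
          ∑ k ∈ Finset.range m, T k x + S x := h1
        rw [hc]
        linarith
      rw [e]
      refine (abs_sub _ _).trans ?_
      have := abs_sub (P x - P x₁) (∑ k ∈ Finset.range m, T k x - ∑ k ∈ Finset.range m, T k x₁)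
      have := hosc1 x hx
      have := hN x
      rw [hB]
      linarith
    have h5 := sq_le_sq' (abs_le.1 h4).1 (abs_le.1 h4).2
    nlinarith [sq_nonneg (pds l u x - c + 2 * S x)]
  refine ⟨c, ?_, ?_⟩
  · rintro rfl
    rw [hc]
    simp only [Finset.range_zero, Finset.sum_empty, sub_zero]
    refine hPc.trans ?_
    gcongr
    have : 0 ≤ 2 * B ^ 2 * ballVol + 2 * D := by positivity
    linarith
  · have hScont : Continuous S := by
      refine continuous_finsetSum _ fun k _ => ?_
      exact (hFT.cv ((testFun_psiS (by positivity)).pds l)).continuous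
    have hint : ∀ {g : E4 → ℝ}, Continuous g → IntegrableOn g (closedBall x₁ r) := fun hg =>
      hg.locallyIntegrable.integrableOn_isCompact (isCompact_closedBall _ _)
    have hi1 : IntegrableOn (fun x => 2 * (S x) ^ 2) (closedBall x₁ r) :=
      hint (continuous_const.mul (hScont.pow 2))
    have hi2 : IntegrableOn (fun _ : E4 => 2 * (B * M) ^ 2) (closedBall x₁ r) :=
      hint continuous_const
    calc _ ≤ ∫ x in closedBall x₁ r, (2 * (B * M) ^ 2 + 2 * (S x) ^ 2) :=
          setIntegral_mono_on
            (hint (((hu.pds l).continuous.sub continuous_const).pow 2)) (hi2.add hi1)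
            measurableSet_closedBall hpt
      _ = 2 * (B * M) ^ 2 * (r ^ 4 * ballVol) + 2 * ∫ x in closedBall x₁ r, (S x) ^ 2 := by
          rw [integral_add hi2 hi1, setIntegral_const,
            integral_const_mul, volume_real_closedBall _ hr0.le, smul_eq_mul]
          ring
      _ ≤ 2 * (B * M) ^ 2 * (r ^ 4 * ballVol) + 2 * (D * M ^ 2 * r ^ 4) := by
          gcongr
          exact integral_sq_cv_le hFT hl hr0 n fun y hy =>
            hFM y (closedBall_subset_closedBall (by linarith) hy)
      _ = (2 * B ^ 2 * ballVol + 2 * D) * M ^ 2 * r ^ 4 := by ring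
      _ ≤ _ := by
          have h0 : 0 ≤ kerC * s⁻¹ ^ 8 * (s ^ 4 * ballVol) := by positivity
          have h1 : 0 ≤ M ^ 2 * r ^ 4 := by positivity
          have := mul_nonneg h0 h1
          linarith

section Bellman

variable {α : Type*} [MeasurableSpace α] {μ : Measure α} {g : α → ℝ}

/-- The mean of `g` over `Q`. -/
def meanOn (μ : Measure α) (g : α → ℝ) (Q : Set α) : ℝ := (∫ x in Q, g x ∂μ) / μ.real Q

/-- The variance of `g` over `Q`. -/
def varOn (μ : Measure α) (g : α → ℝ) (Q : Set α) : ℝ :=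
  meanOn μ (fun x => g x ^ 2) Q - meanOn μ g Q ^ 2

lemma integral_sq_sub_const {Q : Set α} (hQ : 0 < μ.real Q) (hg : IntegrableOn g Q μ)
    (hg2 : IntegrableOn (fun x => g x ^ 2) Q μ) (c : ℝ) :
    ∫ x in Q, (g x - c) ^ 2 ∂μ = μ.real Q * (varOn μ g Q + (meanOn μ g Q - c) ^ 2) := by
  have hfin : μ Q ≠ ⊤ := fun h => by simp [Measure.real, h] at hQ
  have h1 : IntegrableOn (fun x => 2 * c * g x) Q μ := hg.const_mul _
  have h2 : IntegrableOn (fun _ : α => c ^ 2) Q μ := integrableOn_const hfin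
  have h3 : IntegrableOn (fun x => g x ^ 2 - 2 * c * g x) Q μ := hg2.sub h1
  have e : ∀ x, (g x - c) ^ 2 = g x ^ 2 - 2 * c * g x + c ^ 2 := fun x => by ring
  simp only [e]
  rw [integral_add h3 h2, integral_sub hg2 h1, integral_const_mul, setIntegral_const,
    smul_eq_mul, varOn, meanOn, meanOn]
  field_simp
  ring

lemma varOn_nonneg {Q : Set α} (hQ : 0 < μ.real Q) (hg : IntegrableOn g Q μ)
    (hg2 : IntegrableOn (fun x => g x ^ 2) Q μ) : 0 ≤ varOn μ g Q := by
  have h := integral_sq_sub_const hQ hg hg2 (meanOn μ g Q)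
  have h0 : 0 ≤ ∫ x in Q, (g x - meanOn μ g Q) ^ 2 ∂μ := integral_nonneg fun x => sq_nonneg _
  rw [h, sub_self] at h0
  simpa using nonneg_of_mul_nonneg_right h0 hQ

lemma bellman_two_point {v₁ v₂ d : ℝ} (h₁ : 0 ≤ v₁) (h₁' : v₁ ≤ 1) (h₂ : 0 ≤ v₂) (h₂' : v₂ ≤ 1)
    (hv : (v₁ + v₂) / 2 + d ^ 2 ≤ 1) :
    Real.exp (d / 4) * (1 + v₁ - v₁ ^ 2 / 4) + Real.exp (-(d / 4)) * (1 + v₂ - v₂ ^ 2 / 4) ≤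
      2 * (1 + ((v₁ + v₂) / 2 + d ^ 2) - ((v₁ + v₂) / 2 + d ^ 2) ^ 2 / 4) := by
  have hd : |d| ≤ 1 := by
    rw [← sq_le_one_iff_abs_le_one]
    linarith
  have hd4 : |d / 4| ≤ 1 := by rw [abs_div]; norm_num; linarith
  have e1 : Real.exp (d / 4) ≤ 1 + d / 4 + (d / 4) ^ 2 := by
    linarith [(abs_le.1 (Real.abs_exp_sub_one_sub_id_le hd4)).2]
  have e2 : Real.exp (-(d / 4)) ≤ 1 - d / 4 + (d / 4) ^ 2 := by
    linarith [(abs_le.1 (Real.abs_exp_sub_one_sub_id_le (x := -(d / 4)) (by rwa [abs_neg]))).2]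
  have p1 : 0 ≤ 1 + v₁ - v₁ ^ 2 / 4 := by nlinarith
  have p2 : 0 ≤ 1 + v₂ - v₂ ^ 2 / 4 := by nlinarith
  refine (add_le_add (mul_le_mul_of_nonneg_right e1 p1)
    (mul_le_mul_of_nonneg_right e2 p2)).trans ?_
  set w := (v₁ + v₂) / 2 with hw
  set e := (v₁ - v₂) / 2 with he
  have r1 : v₁ = w + e := by rw [hw, he]; ring
  have r2 : v₂ = w - e := by rw [hw, he]; ring
  have hw0 : 0 ≤ w := by rw [hw]; linarith
  have hw1 : w ≤ 1 := by nlinarith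
  rw [r1, r2]
  have k1 : (d / 4) * e * (1 - w / 2) ≤ e ^ 2 / 4 + d ^ 2 / 16 := by
    have q1 : (d / 4) * e * (1 - w / 2) ≤ |(d / 4) * e| := by
      refine (le_abs_self _).trans ?_
      rw [abs_mul _ (1 - w / 2)]
      exact mul_le_of_le_one_right (abs_nonneg _) (abs_le.2 ⟨by linarith, by linarith⟩)
    refine q1.trans (abs_le.2 ⟨?_, ?_⟩)
    · nlinarith [sq_nonneg (e / 2 + d / 4)]
    · nlinarith [sq_nonneg (e / 2 - d / 4)]
  have k2 : d ^ 2 * d ^ 2 ≤ d ^ 2 * (1 - w) := by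
    exact mul_le_mul_of_nonneg_left (by linarith) (sq_nonneg d)
  have k3 : d ^ 2 * w ≤ d ^ 2 := mul_le_of_le_one_right (sq_nonneg d) hw1
  have k4 : 0 ≤ d ^ 2 * w ^ 2 := by positivity
  have k5 : 0 ≤ d ^ 2 * e ^ 2 := by positivity
  nlinarith

/-- Exponential integrability of functions of bounded dyadic mean oscillation. -/
lemma john_nirenberg {𝒟 : ℕ → Set (Set α)}
    (hsplit : ∀ n, ∀ Q ∈ 𝒟 n, ∃ Q₁ ∈ 𝒟 (n + 1), ∃ Q₂ ∈ 𝒟 (n + 1),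
      Disjoint Q₁ Q₂ ∧ Q = Q₁ ∪ Q₂ ∧ μ.real Q₁ = μ.real Q₂)
    (hmeas : ∀ n, ∀ Q ∈ 𝒟 n, MeasurableSet Q ∧ 0 < μ.real Q)
    (hg : ∀ n, ∀ Q ∈ 𝒟 n, IntegrableOn g Q μ)
    (hg2 : ∀ n, ∀ Q ∈ 𝒟 n, IntegrableOn (fun x => g x ^ 2) Q μ)
    (hge : ∀ n, ∀ Q ∈ 𝒟 n, IntegrableOn (fun x => Real.exp (g x / 4)) Q μ)
    (hvar : ∀ n, ∀ Q ∈ 𝒟 n, varOn μ g Q ≤ 1)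
    {N : ℕ} (hosc : ∀ Q ∈ 𝒟 N, ∀ x ∈ Q, ∀ y ∈ Q, g x ≤ g y + 1) {Q : Set α} (hQ : Q ∈ 𝒟 0) :
    ∫ x in Q, Real.exp (g x / 4) ∂μ ≤ 4 * (μ.real Q * Real.exp (meanOn μ g Q / 4)) := by
  have hfin : ∀ n, ∀ Q ∈ 𝒟 n, μ Q ≠ ⊤ := fun n Q hQ h => by
    have := (hmeas n Q hQ).2
    simp [Measure.real, h] at this
  have key : ∀ n k, n + k = N → ∀ Q ∈ 𝒟 n, ∫ x in Q, Real.exp (g x / 4) ∂μ ≤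
      2 * (μ.real Q * (Real.exp (meanOn μ g Q / 4) *
        (1 + varOn μ g Q - varOn μ g Q ^ 2 / 4))) := by
    intro n k
    induction k generalizing n with
    | zero =>
      intro hn Q hQ
      obtain rfl : n = N := by omega
      have hQ0 := (hmeas n Q hQ).2
      have hv0 := varOn_nonneg hQ0 (hg n Q hQ) (hg2 n Q hQ)
      have hv1 := hvar n Q hQ
      have hpt : ∀ x ∈ Q, Real.exp (g x / 4) ≤ 2 * Real.exp (meanOn μ g Q / 4) := by
        intro x hx
        have h1 : g x - 1 ≤ meanOn μ g Q := by
          rw [meanOn, le_div_iff₀ hQ0]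
          calc (g x - 1) * μ.real Q = ∫ _ in Q, (g x - 1) ∂μ := by
                rw [setIntegral_const, smul_eq_mul, mul_comm]
            _ ≤ _ := setIntegral_mono_on (integrableOn_const (hfin n Q hQ)) (hg n Q hQ)
                (hmeas n Q hQ).1 fun y hy => by linarith [hosc Q hQ x hx y hy]
        have h2 : Real.exp (1 / 4) ≤ 2 := by
          have := (abs_le.1 (Real.abs_exp_sub_one_sub_id_le (x := 1 / 4)
            (by rw [abs_of_pos] <;> norm_num))).2
          linarith
        calc Real.exp (g x / 4) ≤ Real.exp (1 / 4 + meanOn μ g Q / 4) := by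
              apply Real.exp_le_exp.2; linarith
          _ = Real.exp (1 / 4) * Real.exp (meanOn μ g Q / 4) := Real.exp_add _ _
          _ ≤ _ := by gcongr
      calc _ ≤ ∫ _ in Q, 2 * Real.exp (meanOn μ g Q / 4) ∂μ :=
            setIntegral_mono_on (hge n Q hQ) (integrableOn_const (hfin n Q hQ))
              (hmeas n Q hQ).1 hpt
        _ = 2 * (μ.real Q * (Real.exp (meanOn μ g Q / 4) * 1)) := by
            rw [setIntegral_const, smul_eq_mul]; ring
        _ ≤ _ := by
            gcongr
            nlinarith
    | succ k ih =>
      intro hn Q hQ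
      obtain ⟨Q₁, hQ₁, Q₂, hQ₂, hd, hU, hμ⟩ := hsplit n Q hQ
      have i1 := ih (n + 1) (by omega) Q₁ hQ₁
      have i2 := ih (n + 1) (by omega) Q₂ hQ₂
      have hm1 := hmeas _ _ hQ₁
      have hm2 := hmeas _ _ hQ₂
      have hv1 := varOn_nonneg hm1.2 (hg _ _ hQ₁) (hg2 _ _ hQ₁)
      have hv2 := varOn_nonneg hm2.2 (hg _ _ hQ₂) (hg2 _ _ hQ₂)
      have hμQ : μ.real Q = 2 * μ.real Q₁ := by
        rw [hU, measureReal_union hd hm2.1 (hfin _ _ hQ₁) (hfin _ _ hQ₂), ← hμ]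
        ring
      have hmean : ∀ f : α → ℝ, IntegrableOn f Q₁ μ → IntegrableOn f Q₂ μ →
          meanOn μ f Q = (meanOn μ f Q₁ + meanOn μ f Q₂) / 2 := by
        intro f hf1 hf2
        rw [meanOn, hμQ, hU, setIntegral_union hd hm2.1 hf1 hf2, meanOn, meanOn, ← hμ]
        have := hm1.2
        field_simp
      have e1 := hmean g (hg _ _ hQ₁) (hg _ _ hQ₂)
      have e2 : varOn μ g Q = (varOn μ g Q₁ + varOn μ g Q₂) / 2 +
          ((meanOn μ g Q₁ - meanOn μ g Q₂) / 2) ^ 2 := by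
        rw [varOn, hmean _ (hg2 _ _ hQ₁) (hg2 _ _ hQ₂), e1, varOn, varOn]
        ring
      have hb := bellman_two_point hv1 (hvar _ _ hQ₁) hv2 (hvar _ _ hQ₂)
        (e2 ▸ hvar n Q hQ)
      rw [← e2] at hb
      have x1 : Real.exp (meanOn μ g Q₁ / 4) = Real.exp (meanOn μ g Q / 4) *
          Real.exp ((meanOn μ g Q₁ - meanOn μ g Q₂) / 2 / 4) := by
        rw [← Real.exp_add, e1]; congr 1; ring
      have x2 : Real.exp (meanOn μ g Q₂ / 4) = Real.exp (meanOn μ g Q / 4) *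
          Real.exp (-((meanOn μ g Q₁ - meanOn μ g Q₂) / 2 / 4)) := by
        rw [← Real.exp_add, e1]; congr 1; ring
      rw [x1] at i1
      rw [x2, ← hμ] at i2
      have := hm1.2
      conv_lhs => rw [hU, setIntegral_union hd hm2.1 (hge _ _ hQ₁) (hge _ _ hQ₂)]
      refine (add_le_add i1 i2).trans ?_
      rw [hμQ]
      have hpos : 0 ≤ 2 * μ.real Q₁ * Real.exp (meanOn μ g Q / 4) := by positivity
      have := mul_le_mul_of_nonneg_left hb hpos
      linarith
  refine (key 0 N (by omega) Q hQ).trans ?_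
  have hv0 := varOn_nonneg (hmeas 0 Q hQ).2 (hg 0 Q hQ) (hg2 0 Q hQ)
  have hv1 := hvar 0 Q hQ
  have h2 : 1 + varOn μ g Q - varOn μ g Q ^ 2 / 4 ≤ 2 := by nlinarith
  calc _ ≤ 2 * (μ.real Q * (Real.exp (meanOn μ g Q / 4) * 2)) := by gcongr
    _ = _ := by ring

end Bellman

lemma exists_rpow_le_exp (p : ℝ) (hp : 0 ≤ p) : ∃ C, 0 < C ∧ ∀ y : ℝ,
    |y| ^ p ≤ C * (Real.exp (y / 4) + Real.exp (-y / 4)) := by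
  obtain ⟨n, hn⟩ := exists_nat_ge p
  refine ⟨1 + n.factorial * 4 ^ n, by positivity, fun y => ?_⟩
  have h1 : Real.exp (|y| / 4) ≤ Real.exp (y / 4) + Real.exp (-y / 4) := by
    rcases abs_cases y with ⟨h, -⟩ | ⟨h, -⟩ <;> rw [h]
    · linarith [Real.exp_pos (-y / 4)]
    · linarith [Real.exp_pos (y / 4)]
  have h2 : (1 : ℝ) ≤ Real.exp (|y| / 4) := Real.one_le_exp (by positivity)
  have h3 : |y| ^ n ≤ n.factorial * 4 ^ n * Real.exp (|y| / 4) := by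
    have := Real.pow_div_factorial_le_exp (|y| / 4) (by positivity) n
    rw [div_pow, div_div, div_le_iff₀ (by positivity)] at this
    linarith
  have h4 : |y| ^ p ≤ 1 + |y| ^ n := by
    rcases le_total |y| 1 with h | h
    · exact (Real.rpow_le_one (abs_nonneg _) h hp).trans (by linarith [pow_nonneg (abs_nonneg y) n])
    · have := Real.rpow_le_rpow_of_exponent_le h hn
      rw [Real.rpow_natCast] at this
      linarith
  calc |y| ^ p ≤ (1 + n.factorial * 4 ^ n) * Real.exp (|y| / 4) := by linarith
    _ ≤ _ := by gcongr

/-- The half-open box with corner `a` and side lengths `h`. -/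
def box (a : E4) (h : Fin 4 → ℝ) : Set E4 := {x | ∀ i, x i ∈ Set.Ico (a i) (a i + h i)}

lemma box_eq_preimage (a : E4) (h : Fin 4 → ℝ) :
    box a h = (MeasurableEquiv.toLp 2 (Fin 4 → ℝ)).symm ⁻¹'
      (Set.univ.pi fun i => Set.Ico (a i) (a i + h i)) := by
  ext x
  simp [box, Set.mem_pi]

lemma measurableSet_box (a : E4) (h : Fin 4 → ℝ) : MeasurableSet (box a h) := by
  rw [box_eq_preimage]
  exact (MeasurableEquiv.measurable _) (MeasurableSet.univ_pi fun i => measurableSet_Ico)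

lemma volume_real_box (a : E4) {h : Fin 4 → ℝ} (hh : ∀ i, 0 ≤ h i) :
    volume.real (box a h) = ∏ i, h i := by
  rw [box_eq_preimage, Measure.real,
    (EuclideanSpace.volume_preserving_symm_measurableEquiv_toLp (Fin 4)).measure_preimage_equiv,
    Real.volume_pi_Ico_toReal]
  · simp
  · intro i
    simpa using hh i

lemma box_subset_closedBall (a : E4) {h : Fin 4 → ℝ} {H : ℝ} (hH : ∀ i, h i ≤ H) :
    box a h ⊆ closedBall a (2 * H) := by
  intro x hx
  have hH0 : 0 ≤ H := by
    have := hx 0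
    have := hH 0
    rw [Set.mem_Ico] at *
    linarith
  rw [mem_closedBall_iff_norm, EuclideanSpace.norm_eq]
  refine Real.sqrt_le_iff.2 ⟨by positivity, ?_⟩
  calc ∑ i, ‖(x - a) i‖ ^ 2 ≤ ∑ _i : Fin 4, H ^ 2 := by
        refine Finset.sum_le_sum fun i _ => ?_
        have := hx i
        rw [Set.mem_Ico] at this
        rw [Real.norm_eq_abs, sq_abs, PiLp.sub_apply]
        have := hH i
        exact pow_le_pow_left₀ (by linarith) (by linarith) 2
    _ = (2 * H) ^ 2 := by simp; ring

/-- The side lengths of the `n`-th generation dyadic boxes, bisected cyclically. -/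
def side (L : ℝ) (n : ℕ) (j : Fin 4) : ℝ := L / 2 ^ ((n + 3 - j) / 4)

lemma side_pos {L : ℝ} (hL : 0 < L) (n : ℕ) (j : Fin 4) : 0 < side L n j := by
  unfold side; positivity

lemma side_le {L : ℝ} (hL : 0 < L) (n : ℕ) (j : Fin 4) : side L n j ≤ L / 2 ^ (n / 4) := by
  unfold side
  gcongr
  · norm_num
  · omega

lemma le_side {L : ℝ} (hL : 0 < L) (n : ℕ) (j : Fin 4) : L / 2 ^ (n / 4 + 1) ≤ side L n j := by
  unfold side
  gcongr
  · norm_num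
  · omega

lemma side_succ_of_ne (L : ℝ) {n : ℕ} {j : Fin 4} (h : (j : ℕ) ≠ n % 4) :
    side L (n + 1) j = side L n j := by
  unfold side
  congr 2
  omega

lemma side_succ_of_eq (L : ℝ) {n : ℕ} {j : Fin 4} (h : (j : ℕ) = n % 4) :
    side L (n + 1) j = side L n j / 2 := by
  unfold side
  rw [show (n + 1 + 3 - (j : ℕ)) / 4 = (n + 3 - j) / 4 + 1 by omega, pow_succ, div_mul_eq_div_div]

lemma box_split (a : E4) {L : ℝ} (hL : 0 < L) (n : ℕ) : ∃ b : E4,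
    Disjoint (box a (side L (n + 1))) (box b (side L (n + 1))) ∧
      box a (side L n) = box a (side L (n + 1)) ∪ box b (side L (n + 1)) := by
  set j : Fin 4 := ⟨n % 4, by omega⟩ with hj
  have hjs : side L (n + 1) j = side L n j / 2 := side_succ_of_eq L rfl
  have hne : ∀ i, i ≠ j → side L (n + 1) i = side L n i := fun i hi =>
    side_succ_of_ne L fun h => hi (Fin.ext h)
  have hp := side_pos hL n j
  have hb : ∀ i, i ≠ j → (a + EuclideanSpace.single j (side L n j / 2)) i = a i := by
    intro i hi
    simp [hi]
  have hbj : (a + EuclideanSpace.single j (side L n j / 2)) j = a j + side L n j / 2 := by simp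
  refine ⟨a + EuclideanSpace.single j (side L n j / 2), ?_, ?_⟩
  · rw [Set.disjoint_left]
    intro x h1 h2
    have h1 := (h1 j).2
    have h2 := (h2 j).1
    rw [hbj] at h2
    rw [hjs] at h1
    linarith
  · ext x
    constructor
    · intro hx
      by_cases hxj : x j < a j + side L n j / 2
      · left
        intro i
        by_cases hi : i = j
        · subst hi
          exact ⟨(hx _).1, by rw [hjs]; exact hxj⟩
        · rw [hne i hi]
          exact hx i
      · right
        intro i
        by_cases hi : i = j
        · subst hi
          refine ⟨by rw [hbj]; linarith, ?_⟩
          rw [hbj, hjs]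
          have := (hx j).2
          linarith
        · rw [hb i hi, hne i hi]
          exact hx i
    · rintro (hx | hx) i
      · by_cases hi : i = j
        · subst hi
          have := hx j
          rw [hjs] at this
          exact ⟨this.1, by linarith [this.2]⟩
        · have := hx i
          rwa [hne i hi] at this
      · by_cases hi : i = j
        · subst hi
          have := hx j
          rw [hjs, hbj] at this
          exact ⟨by linarith [this.1], by linarith [this.2]⟩
        · have := hx i
          rwa [hb i hi, hne i hi] at this

lemma mem_box_self {a : E4} {h : Fin 4 → ℝ} (hh : ∀ i, 0 < h i) : a ∈ box a h :=
  fun i => ⟨le_rfl, by linarith [hh i]⟩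

/-- Interior `L^p` estimate for fourth derivatives. -/
lemma exists_Lp_bound {s p : ℝ} (hs : 0 < s) (hp : 0 < p) : ∃ C, 0 < C ∧
    ∀ u : E4 → ℝ, TestFun u → ∀ l : List (Fin 4), l.length = 4 → ∀ M, 0 < M → ∀ a₀ : E4,
    (∀ y ∈ closedBall a₀ (5 * s), |u y| ≤ M) →
    (∀ y ∈ closedBall a₀ (5 * s), |lapl (lapl u) y| ≤ M) →
    ∫ x in box a₀ (side (s / 2) 0), |pds l u x| ^ p ≤ C * M ^ p := by
  obtain ⟨C₁, hC₁, hosc⟩ := exists_oscillation_bound hs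
  obtain ⟨C₂, hC₂, hexp⟩ := exists_rpow_le_exp p hp.le
  set L := s / 2 with hL
  have hL0 : 0 < L := by positivity
  set Λ := 256 * C₁ + 1 with hΛ
  have hΛ0 : 0 < Λ := by positivity
  set V := volume.real (box (0 : E4) (side L 0)) with hV
  have hV0 : 0 ≤ V := measureReal_nonneg
  refine ⟨Λ ^ p * (C₂ * (8 * (V * Real.exp ((C₁ + 1) / 4)))) + 1, by positivity,
    fun u hu l hl M hM a₀ huM hFM => ?_⟩
  set κ := Λ * M with hκ
  have hκ0 : 0 < κ := by positivity
  set G := pds l u with hG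
  have hGT : TestFun G := hu.pds l
  set Q₀ := box a₀ (side L 0) with hQ₀
  have hvolbox : ∀ a n, volume.real (box a (side L n)) = ∏ i, side L n i := fun a n =>
    volume_real_box a fun i => (side_pos hL0 n i).le
  have hball : ∀ a n, box a (side L n) ⊆ closedBall a (s / 2 ^ (n / 4)) := fun a n => by
    have := box_subset_closedBall a (side_le hL0 n)
    rwa [show 2 * (L / 2 ^ (n / 4)) = s / 2 ^ (n / 4) by rw [hL]; ring] at this
  let 𝒟 : ℕ → Set (Set E4) := fun n => {Q | ∃ a, Q = box a (side L n) ∧ Q ⊆ Q₀}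
  have hvolpos : ∀ a n, 0 < volume.real (box a (side L n)) := fun a n => by
    rw [hvolbox]
    exact Finset.prod_pos fun i _ => side_pos hL0 n i
  have hmeas : ∀ n, ∀ Q ∈ 𝒟 n, MeasurableSet Q ∧ 0 < volume.real Q := by
    rintro n Q ⟨a, rfl, -⟩
    exact ⟨measurableSet_box _ _, hvolpos a n⟩
  have hint : ∀ {f : E4 → ℝ}, Continuous f → ∀ n, ∀ Q ∈ 𝒟 n, IntegrableOn f Q := by
    rintro f hf n Q ⟨a, rfl, -⟩
    exact (hf.locallyIntegrable.integrableOn_isCompact (isCompact_closedBall _ _)).mono_set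
      (hball a n)
  have hsplit : ∀ n, ∀ Q ∈ 𝒟 n, ∃ Q₁ ∈ 𝒟 (n + 1), ∃ Q₂ ∈ 𝒟 (n + 1),
      Disjoint Q₁ Q₂ ∧ Q = Q₁ ∪ Q₂ ∧ volume.real Q₁ = volume.real Q₂ := by
    rintro n Q ⟨a, rfl, hsub⟩
    obtain ⟨b, hd, hU⟩ := box_split a hL0 n
    rw [hU] at hsub
    exact ⟨_, ⟨a, rfl, Set.subset_union_left.trans hsub⟩, _,
      ⟨b, rfl, Set.subset_union_right.trans hsub⟩, hd, hU, by rw [hvolbox, hvolbox]⟩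
  have hQ₀mem : Q₀ ∈ 𝒟 0 := ⟨a₀, rfl, subset_rfl⟩
  have hcorner : ∀ n a, box a (side L n) ⊆ Q₀ → closedBall a (4 * s) ⊆ closedBall a₀ (5 * s) := by
    intro n a hsub
    have h1 := hball a₀ 0 (hsub (mem_box_self (side_pos hL0 n)))
    simp only [Nat.zero_div, pow_zero, div_one] at h1
    refine closedBall_subset_closedBall' ?_
    rw [mem_closedBall] at h1
    linarith
  have hvarsq : ∀ n, ∀ Q ∈ 𝒟 n, ∃ c, (n = 0 → |c| ≤ C₁ * M) ∧
      varOn volume G Q + (meanOn volume G Q - c) ^ 2 ≤ 256 * C₁ * M ^ 2 := by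
    rintro n Q ⟨a, rfl, hsub⟩
    obtain ⟨c, hc, hcI⟩ := hosc u hu l hl M hM a (n / 4)
      (fun y hy => huM y (hcorner n a hsub hy)) (fun y hy => hFM y (hcorner n a hsub hy))
    refine ⟨c, fun h => hc (by simp [h]), ?_⟩
    have hmem : box a (side L n) ∈ 𝒟 n := ⟨a, rfl, hsub⟩
    have h1 := integral_sq_sub_const (hvolpos a n) (hint hGT.continuous n _ hmem)
      (hint (hGT.continuous.pow 2) n _ hmem) c
    have h2 : ∫ x in box a (side L n), (G x - c) ^ 2 ≤
        ∫ x in closedBall a (s / 2 ^ (n / 4)), (G x - c) ^ 2 := by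
      refine setIntegral_mono_set ?_ (Filter.Eventually.of_forall fun x => sq_nonneg _)
        (hball a n).eventuallyLE
      exact ((hGT.continuous.sub continuous_const).pow 2).locallyIntegrable.integrableOn_isCompact
        (isCompact_closedBall _ _)
    have h3 : (s / 2 ^ (n / 4)) ^ 4 ≤ 256 * volume.real (box a (side L n)) := by
      have h4 : (L / 2 ^ (n / 4 + 1)) ^ 4 ≤ volume.real (box a (side L n)) := by
        rw [hvolbox]
        calc (L / 2 ^ (n / 4 + 1)) ^ 4 = ∏ _i : Fin 4, (L / 2 ^ (n / 4 + 1)) := by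
              rw [Finset.prod_const, Finset.card_univ, Fintype.card_fin]
          _ ≤ _ := Finset.prod_le_prod (fun i _ => by positivity) fun i _ => le_side hL0 n i
      calc (s / 2 ^ (n / 4)) ^ 4 = 256 * (L / 2 ^ (n / 4 + 1)) ^ 4 := by
            have h6 : s / 2 ^ (n / 4) = 4 * (L / 2 ^ (n / 4 + 1)) := by
              rw [hL, pow_succ]; ring
            rw [h6]; ring
        _ ≤ _ := by gcongr
    have h5 : volume.real (box a (side L n)) *
        (varOn volume G (box a (side L n)) + (meanOn volume G (box a (side L n)) - c) ^ 2) ≤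
        volume.real (box a (side L n)) * (256 * C₁ * M ^ 2) := by
      rw [← h1]
      refine (h2.trans hcI).trans ?_
      calc _ ≤ C₁ * M ^ 2 * (256 * volume.real (box a (side L n))) := by gcongr
        _ = _ := by ring
    exact le_of_mul_le_mul_left h5 (hvolpos a n)
  have hΛsq : 256 * C₁ * M ^ 2 ≤ κ ^ 2 := by
    rw [hκ, mul_pow]
    gcongr
    rw [hΛ]
    nlinarith
  have hmean_mul : ∀ (c : ℝ) (Q : Set E4),
      meanOn volume (fun x => c * G x) Q = c * meanOn volume G Q := by
    intro c Q
    rw [meanOn, integral_const_mul, meanOn]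
    ring
  have hvar_mul : ∀ (c : ℝ) (Q : Set E4),
      varOn volume (fun x => c * G x) Q = c ^ 2 * varOn volume G Q := by
    intro c Q
    rw [varOn, hmean_mul, varOn]
    simp only [meanOn, mul_pow, integral_const_mul]
    ring
  obtain ⟨D, hD, hlip⟩ := hGT.lipschitz
  have main : ∀ σ : ℝ, |σ| = 1 → ∫ x in Q₀, Real.exp (σ * κ⁻¹ * G x / 4) ≤
      4 * (V * Real.exp ((C₁ + 1) / 4)) := by
    intro σ hσ
    have hσ2 : σ ^ 2 = 1 := by rw [← sq_abs, hσ, one_pow]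
    have hcont : Continuous fun x => σ * κ⁻¹ * G x := continuous_const.mul hGT.continuous
    obtain ⟨N, hN⟩ : ∃ N : ℕ, κ⁻¹ * (D * (2 * (s / 2 ^ N))) ≤ 1 := by
      have ht := (tendsto_pow_atTop_nhds_zero_of_lt_one (r := (1 / 2 : ℝ)) (by norm_num)
        (by norm_num)).const_mul (κ⁻¹ * D * 2 * s)
      rw [mul_zero] at ht
      obtain ⟨N, hN⟩ := (ht.eventually (gt_mem_nhds one_pos)).exists
      refine ⟨N, hN.le.trans' (le_of_eq ?_)⟩
      rw [one_div, inv_pow]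
      ring
    have jn := john_nirenberg (μ := volume) (g := fun x => σ * κ⁻¹ * G x) hsplit hmeas (hint hcont)
      (hint (hcont.pow 2)) (hint (Real.continuous_exp.comp (hcont.div_const 4))) ?_
      (N := 4 * N) ?_ hQ₀mem
    · refine jn.trans ?_
      obtain ⟨c, hc, hcv⟩ := hvarsq 0 Q₀ hQ₀mem
      have hc := hc rfl
      have hvn := varOn_nonneg (hvolpos a₀ 0) (hint hGT.continuous 0 _ hQ₀mem)
        (hint (hGT.continuous.pow 2) 0 _ hQ₀mem)
      have h1 : |meanOn volume G Q₀ - c| ≤ κ := abs_le_of_sq_le_sq (by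
        linarith) hκ0.le
      have h2 : |meanOn volume G Q₀| ≤ (C₁ + 1) * κ := by
        have h3 : |meanOn volume G Q₀| ≤ |meanOn volume G Q₀ - c| + |c| := by
          simpa using abs_add_le (meanOn volume G Q₀ - c) c
        have h4 : C₁ * M ≤ C₁ * κ := by
          gcongr
          rw [hκ, hΛ]
          nlinarith
        linarith
      have h5 : σ * κ⁻¹ * meanOn volume G Q₀ ≤ C₁ + 1 := by
        refine (le_abs_self _).trans ?_
        rw [abs_mul, abs_mul, hσ, abs_of_pos (inv_pos.2 hκ0), one_mul, inv_mul_le_iff₀ hκ0]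
        linarith
      have h6 : volume.real Q₀ = V := by rw [hV, hQ₀, hvolbox, hvolbox]
      rw [hmean_mul, h6]
      gcongr
    · intro n Q hQ
      obtain ⟨c, -, hcv⟩ := hvarsq n Q hQ
      rw [hvar_mul, mul_pow, hσ2, one_mul, inv_pow, inv_mul_le_iff₀ (by positivity)]
      linarith [sq_nonneg (meanOn volume G Q - c)]
    · rintro Q ⟨a, rfl, -⟩ x hx y hy
      have hx := hball a _ hx
      have hy := hball a _ hy
      rw [Nat.mul_div_cancel_left _ (by norm_num : 0 < 4), mem_closedBall] at hx hy
      have h1 : ‖x - y‖ ≤ 2 * (s / 2 ^ N) := by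
        rw [← dist_eq_norm]
        linarith [dist_triangle_right x y a]
      have h2 : σ * κ⁻¹ * (G x - G y) ≤ 1 := by
        refine (le_abs_self _).trans ?_
        rw [abs_mul, abs_mul, hσ, abs_of_pos (inv_pos.2 hκ0), one_mul]
        refine le_trans ?_ hN
        gcongr
        exact (hlip x y).trans (by gcongr)
      linarith
  have hpt : ∀ x, |G x| ^ p ≤ κ ^ p * (C₂ * (Real.exp (1 * κ⁻¹ * G x / 4) +
      Real.exp (-1 * κ⁻¹ * G x / 4))) := by
    intro x
    have h1 := hexp (κ⁻¹ * G x)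
    have h2 : |G x| ^ p = κ ^ p * |κ⁻¹ * G x| ^ p := by
      rw [← Real.mul_rpow hκ0.le (abs_nonneg _), abs_mul, abs_of_pos (inv_pos.2 hκ0),
        mul_inv_cancel_left₀ hκ0.ne']
    rw [h2]
    gcongr
    simpa [neg_mul] using h1
  have hI : ∀ σ : ℝ, IntegrableOn (fun x => Real.exp (σ * κ⁻¹ * G x / 4)) Q₀ := fun σ =>
    hint (Real.continuous_exp.comp ((continuous_const.mul hGT.continuous).div_const 4)) 0 _ hQ₀mem
  calc ∫ x in Q₀, |G x| ^ p ≤ ∫ x in Q₀, κ ^ p * (C₂ * (Real.exp (1 * κ⁻¹ * G x / 4) +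
        Real.exp (-1 * κ⁻¹ * G x / 4))) := by
        refine integral_mono_of_nonneg (Filter.Eventually.of_forall fun x => by positivity)
          ((((hI 1).add (hI (-1))).const_mul C₂).const_mul (κ ^ p))
          (Filter.Eventually.of_forall hpt)
    _ = κ ^ p * (C₂ * ((∫ x in Q₀, Real.exp (1 * κ⁻¹ * G x / 4)) +
        ∫ x in Q₀, Real.exp (-1 * κ⁻¹ * G x / 4))) := by
        rw [integral_const_mul, integral_const_mul, integral_add (hI 1) (hI (-1))]
    _ ≤ κ ^ p * (C₂ * (4 * (V * Real.exp ((C₁ + 1) / 4)) + 4 * (V * Real.exp ((C₁ + 1) / 4)))) := by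
        gcongr
        · exact main 1 (by simp)
        · exact main (-1) (by simp)
    _ = Λ ^ p * (C₂ * (8 * (V * Real.exp ((C₁ + 1) / 4)))) * M ^ p := by
        rw [hκ, Real.mul_rpow hΛ0.le hM.le]
        ring
    _ ≤ _ := by
        have : 0 ≤ M ^ p := by positivity
        linarith

section Jets

variable {K : ℕ}

/-- The `k`-th coordinate of a Euclidean-valued map. -/
def coord (v : E4 → EuclideanSpace ℝ (Fin K)) (k : Fin K) : E4 → ℝ := fun x => v x k

theorem ContDiff.coord {v : E4 → EuclideanSpace ℝ (Fin K)} (hv : ContDiff ℝ (⊤ : ℕ∞) v)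
    (k : Fin K) : ContDiff ℝ (⊤ : ℕ∞) (coord v k) :=
  (EuclideanSpace.proj (𝕜 := ℝ) k).contDiff.comp hv

theorem pd_comp_coord {v : E4 → EuclideanSpace ℝ (Fin K)} (hv : ContDiff ℝ (⊤ : ℕ∞) v)
    (i : Fin 4) (k : Fin K) : pd i (coord v k) = coord (pd i v) k := by
  funext x
  have h := (EuclideanSpace.proj k : EuclideanSpace ℝ (Fin K) →L[ℝ] ℝ).hasFDerivAt.comp x
    (hv.diffble x).hasFDerivAt
  have h2 : fderiv ℝ (coord v k) x = _ := h.fderiv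
  rw [pd, h2]
  rfl

theorem pds_coord {v : E4 → EuclideanSpace ℝ (Fin K)} (hv : ContDiff ℝ (⊤ : ℕ∞) v)
    (l : List (Fin 4)) (k : Fin K) : pds l (coord v k) = coord (pds l v) k := by
  induction l with
  | nil => rfl
  | cons i l ih => rw [pds, ih, pd_comp_coord (hv.pds l)]; rfl

theorem norm_le_sum_abs_coord (y : EuclideanSpace ℝ (Fin K)) : ‖y‖ ≤ ∑ k, |y k| := by
  have h : y = ∑ k, EuclideanSpace.single k (y k) := by
    ext j
    simp [Finset.sum_apply, Pi.single_apply]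
  calc ‖y‖ = ‖∑ k, EuclideanSpace.single k (y k)‖ := by rw [← h]
    _ ≤ ∑ k, ‖EuclideanSpace.single k (y k)‖ := norm_sum_le _ _
    _ = _ := by simp

theorem abs_coord_le (y : EuclideanSpace ℝ (Fin K)) (k : Fin K) : |y k| ≤ ‖y‖ :=
  PiLp.norm_apply_le y k

variable {V : Type*} [NormedAddCommGroup V] [NormedSpace ℝ V]

theorem iteratedFDeriv_single_eq_pds {v : E4 → V} (hv : ContDiff ℝ (⊤ : ℕ∞) v) {j : ℕ}
    (α : Fin j → Fin 4) (x : E4) :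
    iteratedFDeriv ℝ j v x (fun i => EuclideanSpace.single (α i) (1 : ℝ)) =
      pds (List.ofFn α) v x := by
  induction j generalizing x with
  | zero => simp [pds]
  | succ j ih =>
    rw [iteratedFDeriv_succ_apply_left, List.ofFn_succ, pds, pd]
    have h : pds (List.ofFn fun i : Fin j => α i.succ) v = fun y =>
        iteratedFDeriv ℝ j v y (fun i => EuclideanSpace.single (α i.succ) (1 : ℝ)) :=
      funext fun y => (ih (fun i => α i.succ) y).symm
    rw [h, fderiv_continuousMultilinear_apply_const_apply]
    · rfl
    · exact (hv.differentiable_iteratedFDeriv (WithTop.coe_lt_coe.2 (WithTop.coe_lt_top j))) x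

theorem ContinuousMultilinearMap.norm_le_sum_single {j : ℕ}
    (f : ContinuousMultilinearMap ℝ (fun _ : Fin j => E4) V) :
    ‖f‖ ≤ ∑ α : Fin j → Fin 4, ‖f (fun i => EuclideanSpace.single (α i) (1 : ℝ))‖ := by
  refine f.opNorm_le_bound (by positivity) fun m => ?_
  have hm : m = fun i => ∑ c : Fin 4, m i c • EuclideanSpace.single c (1 : ℝ) := by
    funext i
    ext c
    simp [Finset.sum_apply, Pi.single_apply]
  have h1 : f m = ∑ α : Fin j → Fin 4,
      (∏ i, m i (α i)) • f (fun i => EuclideanSpace.single (α i) (1 : ℝ)) := by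
    conv_lhs => rw [hm]
    rw [f.map_sum]
    exact Finset.sum_congr rfl fun α _ => f.map_smul_univ _ _
  rw [h1, Finset.sum_mul]
  refine (norm_sum_le _ _).trans (Finset.sum_le_sum fun α _ => ?_)
  rw [norm_smul, mul_comm, norm_prod]
  gcongr with i
  exact PiLp.norm_apply_le (m i) (α i)

theorem norm_iteratedFDeriv_le_sum_pds {v : E4 → EuclideanSpace ℝ (Fin K)}
    (hv : ContDiff ℝ (⊤ : ℕ∞) v) (j : ℕ) (x : E4) :
    ‖iteratedFDeriv ℝ j v x‖ ≤
      ∑ α : Fin j → Fin 4, ∑ k, |pds (List.ofFn α) (coord v k) x| := by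
  refine (ContinuousMultilinearMap.norm_le_sum_single _).trans (Finset.sum_le_sum fun α _ => ?_)
  rw [iteratedFDeriv_single_eq_pds hv]
  simp only [pds_coord hv]
  exact norm_le_sum_abs_coord _

theorem lap_eq_sum_pd {v : E4 → V} (hv : ContDiff ℝ (⊤ : ℕ∞) v) :
    lap v = fun x => ∑ i, pd i (pd i v) x := by
  funext x
  refine Finset.sum_congr rfl fun i _ => ?_
  have h := iteratedFDeriv_single_eq_pds hv ![i, i] x
  have h2 : (fun c : Fin 2 => EuclideanSpace.single ((![i, i] : Fin 2 → Fin 4) c) (1 : ℝ)) =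
      ![EuclideanSpace.single i (1 : ℝ), EuclideanSpace.single i (1 : ℝ)] := by
    funext c; fin_cases c <;> rfl
  rw [h2] at h
  rw [h]
  rfl

theorem contDiff_lap {v : E4 → V} (hv : ContDiff ℝ (⊤ : ℕ∞) v) :
    ContDiff ℝ (⊤ : ℕ∞) (lap v) := by
  rw [lap_eq_sum_pd hv]
  exact ContDiff.sum fun i _ => (hv.pd i).pd i

theorem lapl_coord {v : E4 → EuclideanSpace ℝ (Fin K)} (hv : ContDiff ℝ (⊤ : ℕ∞) v)
    (k : Fin K) : lapl (coord v k) = coord (lap v) k := by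
  funext x
  rw [lap_eq_sum_pd hv]
  simp only [lapl, pd_comp_coord hv, pd_comp_coord (hv.pd _)]
  simp [coord]

theorem norm_fderiv_lap_le {v : E4 → V} (hv : ContDiff ℝ (⊤ : ℕ∞) v) (x : E4) :
    ‖fderiv ℝ (lap v) x‖ ≤ 4 * ‖iteratedFDeriv ℝ 3 v x‖ := by
  have hd : DifferentiableAt ℝ (iteratedFDeriv ℝ 2 v) x :=
    (hv.differentiable_iteratedFDeriv (WithTop.coe_lt_coe.2 (WithTop.coe_lt_top 2))) x
  refine ContinuousLinearMap.opNorm_le_bound _ (by positivity) fun y => ?_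
  have h : fderiv ℝ (lap v) x y = ∑ i : Fin 4, fderiv ℝ (iteratedFDeriv ℝ 2 v) x y
      ![EuclideanSpace.single i (1 : ℝ), EuclideanSpace.single i (1 : ℝ)] := by
    have h1 : lap v = fun z => ∑ i : Fin 4, iteratedFDeriv ℝ 2 v z
      ![EuclideanSpace.single i (1 : ℝ), EuclideanSpace.single i (1 : ℝ)] := rfl
    rw [h1, fderiv_fun_sum fun i _ => hd.continuousMultilinear_apply_const _,
      sum_apply]
    exact Finset.sum_congr rfl fun i _ => fderiv_continuousMultilinear_apply_const_apply hd _ _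
  rw [h]
  calc _ ≤ ∑ i : Fin 4, ‖fderiv ℝ (iteratedFDeriv ℝ 2 v) x y
          ![EuclideanSpace.single i (1 : ℝ), EuclideanSpace.single i (1 : ℝ)]‖ := norm_sum_le _ _
    _ ≤ ∑ _i : Fin 4, ‖iteratedFDeriv ℝ 3 v x‖ * ‖y‖ := by
        refine Finset.sum_le_sum fun i _ => ?_
        refine (ContinuousMultilinearMap.le_opNorm _ _).trans ?_
        rw [Fin.prod_univ_two]
        simp only [Matrix.cons_val_zero, Matrix.cons_val_one, PiLp.norm_single,
          norm_one, mul_one]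
        rw [← norm_fderiv_iteratedFDeriv]
        exact ContinuousLinearMap.le_opNorm _ _
    _ = _ := by simp; ring

theorem norm_sphereAvg_le {r B : ℝ} (hB : 0 ≤ B) {g : E4 → V}
    (hg : ∀ y ∈ sphere (0 : E4) r, ‖g y‖ ≤ B) : ‖sphereAvg r g‖ ≤ B := by
  rw [sphereAvg, norm_smul, norm_inv, Real.norm_eq_abs, abs_of_nonneg ENNReal.toReal_nonneg]
  rcases eq_or_ne (μH[3] (sphere (0 : E4) r)) ⊤ with h | h
  · simpa [h] using hB
  · have h1 := norm_setIntegral_le_of_norm_le_const (μ := μH[3]) (lt_top_iff_ne_top.2 h) hg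
    rcases eq_or_lt_of_le (ENNReal.toReal_nonneg (a := μH[3] (sphere (0 : E4) r))) with h0 | h0
    · simpa [← h0] using hB
    · rw [inv_mul_le_iff₀ h0]
      rw [mul_comm]
      exact h1

/-- The sum of the norms of the derivatives of order at most three. -/
def jetNorm (v : E4 → V) (x : E4) : ℝ := ∑ j ∈ Finset.range 4, ‖iteratedFDeriv ℝ j v x‖

theorem jetNorm_nonneg (v : E4 → V) (x : E4) : 0 ≤ jetNorm v x :=
  Finset.sum_nonneg fun _ _ => norm_nonneg _

theorem norm_iteratedFDeriv_le_jetNorm (v : E4 → V) (x : E4) {j : ℕ} (hj : j < 4) :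
    ‖iteratedFDeriv ℝ j v x‖ ≤ jetNorm v x :=
  Finset.single_le_sum (f := fun j => ‖iteratedFDeriv ℝ j v x‖) (fun _ _ => norm_nonneg _)
    (Finset.mem_range.2 hj)

theorem norm_coeff_sum_le {v : E4 → EuclideanSpace ℝ (Fin K)} (hv : ContDiff ℝ (⊤ : ℕ∞) v)
    (c₁ : (E4 →L[ℝ] EuclideanSpace ℝ (Fin K)) →L[ℝ] EuclideanSpace ℝ (Fin K))
    (c₂ : (E4 →L[ℝ] E4 →L[ℝ] EuclideanSpace ℝ (Fin K)) →L[ℝ] EuclideanSpace ℝ (Fin K))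
    (c₃ : (E4 →L[ℝ] EuclideanSpace ℝ (Fin K)) →L[ℝ] EuclideanSpace ℝ (Fin K))
    (c₄ : EuclideanSpace ℝ (Fin K) →L[ℝ] EuclideanSpace ℝ (Fin K)) {C₀ B : ℝ} {y : E4}
    (hc : ‖c₁‖ + ‖c₂‖ + ‖c₃‖ + ‖c₄‖ ≤ C₀) (hB : jetNorm v y ≤ B) :
    ‖c₁ (fderiv ℝ (lap v) y) + c₂ (fderiv ℝ (fderiv ℝ v) y) + c₃ (fderiv ℝ v y) + c₄ (v y)‖ ≤
      4 * C₀ * B := by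
  have hB0 : 0 ≤ B := (jetNorm_nonneg v y).trans hB
  have hj : ∀ j < 4, ‖iteratedFDeriv ℝ j v y‖ ≤ B := fun j hj =>
    (norm_iteratedFDeriv_le_jetNorm v y hj).trans hB
  have h1 : ‖c₁ (fderiv ℝ (lap v) y)‖ ≤ ‖c₁‖ * (4 * B) :=
    c₁.le_opNorm_of_le ((norm_fderiv_lap_le hv y).trans (by have := hj 3 (by norm_num); linarith))
  have h2 : ‖c₂ (fderiv ℝ (fderiv ℝ v) y)‖ ≤ ‖c₂‖ * B := by
    refine c₂.le_opNorm_of_le ?_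
    have h := hj 2 (by norm_num)
    rw [← norm_iteratedFDeriv_fderiv, norm_iteratedFDeriv_one] at h
    exact h
  have h3 : ‖c₃ (fderiv ℝ v y)‖ ≤ ‖c₃‖ * B := by
    refine c₃.le_opNorm_of_le ?_
    have h := hj 1 (by norm_num)
    rwa [norm_iteratedFDeriv_one] at h
  have h4 : ‖c₄ (v y)‖ ≤ ‖c₄‖ * B := by
    refine c₄.le_opNorm_of_le ?_
    have h := hj 0 (by norm_num)
    rwa [norm_iteratedFDeriv_zero] at h
  have h5 := norm_add₄_le (a := c₁ (fderiv ℝ (lap v) y)) (b := c₂ (fderiv ℝ (fderiv ℝ v) y))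
    (c := c₃ (fderiv ℝ v y)) (d := c₄ (v y))
  have h6 := mul_le_mul_of_nonneg_right hc hB0
  have h7 := mul_nonneg (norm_nonneg c₂) hB0
  have h8 := mul_nonneg (norm_nonneg c₃) hB0
  have h9 := mul_nonneg (norm_nonneg c₄) hB0
  linarith

end Jets

section Absorption

/-- The distance from the boundary of the annulus `{5/4 ≤ ‖x‖ ≤ 15/4}`. -/
def bdist (x : E4) : ℝ := min (‖x‖ - 5 / 4) (15 / 4 - ‖x‖)

/-- The closed annulus `{5/4 ≤ ‖x‖ ≤ 15/4}`. -/
def midAnnulus : Set E4 := {x | 5 / 4 ≤ ‖x‖ ∧ ‖x‖ ≤ 15 / 4}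

theorem mem_midAnnulus_iff {x : E4} : x ∈ midAnnulus ↔ 0 ≤ bdist x := by
  simp [midAnnulus, bdist]

theorem bdist_le (x : E4) : bdist x ≤ 5 / 4 := by
  rcases le_total ‖x‖ (5 / 2) with h | h
  · exact (min_le_left _ _).trans (by linarith)
  · exact (min_le_right _ _).trans (by linarith)

theorem continuous_bdist : Continuous bdist := by unfold bdist; fun_prop

theorem bdist_sub_le (x y : E4) : bdist x - ‖y - x‖ ≤ bdist y := by
  have h := abs_le.1 (abs_norm_sub_norm_le y x)
  have h1 : bdist x ≤ ‖x‖ - 5 / 4 := min_le_left _ _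
  have h2 : bdist x ≤ 15 / 4 - ‖x‖ := min_le_right _ _
  exact le_min (by linarith) (by linarith)

theorem isCompact_midAnnulus : IsCompact midAnnulus := by
  refine (isCompact_closedBall (0 : E4) (15 / 4)).of_isClosed_subset ?_ ?_
  · exact (isClosed_le continuous_const continuous_norm).inter
      (isClosed_le continuous_norm continuous_const)
  · intro x hx
    simpa using hx.2

variable {V : Type*} [NormedAddCommGroup V] [NormedSpace ℝ V]

/-- The jet norm weighted by powers of the distance from the boundary of the annulus. -/
def weightedJet (v : E4 → V) (x : E4) : ℝ :=
  ∑ j ∈ Finset.range 4, bdist x ^ (4 + j) * ‖iteratedFDeriv ℝ j v x‖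

theorem bdist_pow_mul_jetNorm_le (v : E4 → V) {x : E4} (hx : 0 ≤ bdist x) :
    bdist x ^ 7 * jetNorm v x ≤ 2 * weightedJet v x := by
  rw [jetNorm, weightedJet, Finset.mul_sum, Finset.mul_sum]
  refine Finset.sum_le_sum fun j hj => ?_
  have hj' : j < 4 := Finset.mem_range.1 hj
  have h1 : bdist x ^ (3 - j) ≤ 2 := by
    calc bdist x ^ (3 - j) ≤ (5 / 4) ^ (3 - j) := pow_le_pow_left₀ hx (bdist_le x) _
      _ ≤ (5 / 4) ^ 3 := pow_le_pow_right₀ (by norm_num) (by omega)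
      _ ≤ 2 := by norm_num
  have h2 : bdist x ^ 7 = bdist x ^ (4 + j) * bdist x ^ (3 - j) := by
    rw [← pow_add]; congr 1; omega
  rw [h2]
  have h3 : 0 ≤ bdist x ^ (4 + j) * ‖iteratedFDeriv ℝ j v x‖ := by positivity
  nlinarith

theorem continuous_weightedJet {v : E4 → V} (hv : ContDiff ℝ (⊤ : ℕ∞) v) :
    Continuous (weightedJet v) := by
  refine continuous_finsetSum _ fun j _ => (continuous_bdist.pow _).mul ?_
  exact (hv.continuous_iteratedFDeriv (by exact_mod_cast le_top)).norm

theorem pow_mul_norm_iteratedFDeriv_le {K : ℕ} {v : E4 → EuclideanSpace ℝ (Fin K)}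
    (hv : ContDiff ℝ (⊤ : ℕ∞) v) (hvk : ∀ k, TestFun (coord v k)) {j : ℕ} (hj : j < 4)
    {s M I : ℝ} (hs : 0 < s) {x : E4} (hI0 : 0 ≤ I) (hM0 : 0 ≤ M)
    (hI : ∀ k, ∫ y in closedBall x s, |coord v k y| ≤ I)
    (hM : ∀ k, ∀ y ∈ closedBall x s, |lapl (lapl (coord v k)) y| ≤ M) :
    s ^ j * ‖iteratedFDeriv ℝ j v x‖ ≤
      64 * K * (kerC * s⁻¹ ^ 4 * I + 2 * kerC * ballVol * (s ^ 4 * M)) := by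
  have hk := kerC_pos
  have hb := ballVol_nonneg
  set R := kerC * s⁻¹ ^ 4 * I + 2 * kerC * ballVol * (s ^ 4 * M) with hR
  have hR0 : 0 ≤ R := by positivity
  calc s ^ j * ‖iteratedFDeriv ℝ j v x‖
      ≤ s ^ j * ∑ α : Fin j → Fin 4, ∑ k, |pds (List.ofFn α) (coord v k) x| := by
        gcongr
        exact norm_iteratedFDeriv_le_sum_pds hv j x
    _ = ∑ α : Fin j → Fin 4, ∑ k, s ^ j * |pds (List.ofFn α) (coord v k) x| := by
        rw [Finset.mul_sum]
        exact Finset.sum_congr rfl fun α _ => Finset.mul_sum _ _ _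
    _ ≤ ∑ _α : Fin j → Fin 4, ∑ _k : Fin K, R := by
        refine Finset.sum_le_sum fun α _ => Finset.sum_le_sum fun k _ => ?_
        have h := abs_pds_le (hvk k) (l := List.ofFn α) (by simp; omega) hs (hM k)
        rw [List.length_ofFn] at h
        refine h.trans ?_
        rw [hR]
        gcongr
        exact hI k
    _ = 4 ^ j * (K * R) := by simp
    _ ≤ 4 ^ 3 * (K * R) := by
        gcongr
        · norm_num
        · omega
    _ = _ := by ring

theorem exists_jetNorm_bound (K : ℕ) {C₁ : ℝ} (hC₁ : 0 < C₁) :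
    ∃ C : ℝ, 0 < C ∧ ∀ v : E4 → EuclideanSpace ℝ (Fin K), ContDiff ℝ (⊤ : ℕ∞) v →
      (∀ k, TestFun (coord v k)) →
      (∀ x ∈ midAnnulus, ∀ B, (∀ z, ‖z‖ = ‖x‖ → jetNorm v z ≤ B) →
        ∀ k, |lapl (lapl (coord v k)) x| ≤ C₁ * B) →
      ∀ x : E4, 3 / 2 ≤ ‖x‖ → ‖x‖ ≤ 7 / 2 →
        jetNorm v x ≤ C * ∫ y in midAnnulus, ‖v y‖ := by
  have hk := kerC_pos
  have hb := ballVol_nonneg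
  set P := kerC with hP
  set Q := 2 * kerC * ballVol with hQ
  have hQ0 : 0 ≤ Q := by positivity
  set Λ : ℝ := 256 * 320 * K * Q * C₁ with hΛ
  have hΛ0 : 0 ≤ Λ := by positivity
  obtain ⟨η, hη0, hη1, hηΛ⟩ : ∃ η : ℝ, 0 < η ∧ η ≤ 1 / 2 ∧ Λ * η ≤ 1 / 2 := by
    refine ⟨1 / (2 * (1 + Λ)), by positivity, ?_, ?_⟩
    · rw [div_le_div_iff₀ (by positivity) (by norm_num)]; linarith
    · rw [mul_one_div, div_le_div_iff₀ (by positivity) (by norm_num)]; linarith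
  refine ⟨2 * 4 ^ 7 * (512 * K * P * η⁻¹ ^ 7) + 1, by positivity, ?_⟩
  intro v hv hvk hyp
  set I := ∫ y in midAnnulus, ‖v y‖ with hI
  have hI0 : 0 ≤ I := integral_nonneg fun _ => norm_nonneg _
  obtain ⟨x₀, hx₀, hmax⟩ := isCompact_midAnnulus.exists_isMaxOn
    ⟨EuclideanSpace.single 0 2, by norm_num [midAnnulus]⟩ (continuous_weightedJet hv).continuousOn
  set X := weightedJet v x₀ with hX
  have hmax' : ∀ x ∈ midAnnulus, weightedJet v x ≤ X := fun x hx => hmax hx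
  have hX0 : 0 ≤ X := Finset.sum_nonneg fun j _ =>
    mul_nonneg (pow_nonneg (mem_midAnnulus_iff.1 hx₀) _) (norm_nonneg _)
  have hXI : X ≤ 512 * K * P * η⁻¹ ^ 7 * I := by
    rcases eq_or_lt_of_le (mem_midAnnulus_iff.1 hx₀) with hd | hd
    · have : X = 0 := by
        rw [hX, weightedJet]
        exact Finset.sum_eq_zero fun j _ => by rw [← hd]; simp
      rw [this]
      positivity
    · set δ := bdist x₀ with hδ
      have hs : 0 < η * δ := by positivity
      have hball : ∀ y ∈ closedBall x₀ (η * δ), δ / 2 ≤ bdist y := by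
        intro y hy
        rw [mem_closedBall, dist_eq_norm] at hy
        have h := bdist_sub_le x₀ y
        nlinarith
      have hballA : closedBall x₀ (η * δ) ⊆ midAnnulus := fun y hy =>
        mem_midAnnulus_iff.2 ((by positivity : 0 ≤ δ / 2).trans (hball y hy))
      have hM : ∀ k, ∀ y ∈ closedBall x₀ (η * δ),
          |lapl (lapl (coord v k)) y| ≤ C₁ * (256 * X * δ⁻¹ ^ 7) := by
        intro k y hy
        refine hyp y (hballA hy) _ (fun z hz => ?_) k
        have hzy : bdist z = bdist y := by rw [bdist, hz, bdist]
        have hz2 : δ / 2 ≤ bdist z := hzy ▸ hball y hy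
        have hz0 : 0 ≤ bdist z := (by positivity : 0 ≤ δ / 2).trans hz2
        have h1 := (bdist_pow_mul_jetNorm_le v hz0).trans
          (mul_le_mul_of_nonneg_left (hmax' z (mem_midAnnulus_iff.2 hz0)) zero_le_two)
        have h2 : (δ / 2) ^ 7 * jetNorm v z ≤ 2 * X :=
          (mul_le_mul_of_nonneg_right (pow_le_pow_left₀ (by positivity) hz2 7)
            (jetNorm_nonneg v z)).trans h1
        rw [inv_pow, ← div_eq_mul_inv, le_div_iff₀ (by positivity)]
        linarith [show (δ / 2) ^ 7 * jetNorm v z = jetNorm v z * δ ^ 7 / 128 by ring]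
      have hIk : ∀ k, ∫ y in closedBall x₀ (η * δ), |coord v k y| ≤ I := by
        intro k
        have hci : IntegrableOn (fun y => ‖v y‖) midAnnulus :=
          hv.continuous.norm.continuousOn.integrableOn_compact isCompact_midAnnulus
        calc ∫ y in closedBall x₀ (η * δ), |coord v k y|
            ≤ ∫ y in closedBall x₀ (η * δ), ‖v y‖ :=
              integral_mono_of_nonneg (Filter.Eventually.of_forall fun _ => abs_nonneg _)
                (hci.mono_set hballA)
                (Filter.Eventually.of_forall fun y => abs_coord_le (v y) k)
          _ ≤ I := setIntegral_mono_set hci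
              (Filter.Eventually.of_forall fun _ => norm_nonneg _) hballA.eventuallyLE
      have hterm : ∀ j ∈ Finset.range 4, δ ^ (4 + j) * ‖iteratedFDeriv ℝ j v x₀‖ ≤
          64 * K * (P * η⁻¹ ^ 7 * I + 320 * Q * C₁ * η * X) := by
        intro j hj
        have hj' : j < 4 := Finset.mem_range.1 hj
        have h := pow_mul_norm_iteratedFDeriv_le hv hvk hj' hs hI0
          (by positivity : 0 ≤ C₁ * (256 * X * δ⁻¹ ^ 7)) hIk hM
        rw [← hP, ← hQ] at h
        have h1 : η ^ 3 * (δ ^ (4 + j) * ‖iteratedFDeriv ℝ j v x₀‖) ≤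
            δ ^ 4 * ((η * δ) ^ j * ‖iteratedFDeriv ℝ j v x₀‖) := by
          have h2 : η ^ 3 ≤ η ^ j := pow_le_pow_of_le_one hη0.le (by linarith) (by omega)
          calc _ ≤ η ^ j * (δ ^ (4 + j) * ‖iteratedFDeriv ℝ j v x₀‖) := by gcongr
            _ = _ := by rw [mul_pow, pow_add]; ring
        have h3 : δ ^ 4 * (64 * K * (P * (η * δ)⁻¹ ^ 4 * I +
            Q * ((η * δ) ^ 4 * (C₁ * (256 * X * δ⁻¹ ^ 7))))) =
            64 * K * (P * η⁻¹ ^ 4 * I + 256 * Q * C₁ * η ^ 4 * X * δ) := by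
          field_simp
        have h4 := h1.trans (mul_le_mul_of_nonneg_left h (by positivity : 0 ≤ δ ^ 4))
        rw [h3] at h4
        have h5 : η ^ 3 * (64 * K * (P * η⁻¹ ^ 7 * I + 320 * Q * C₁ * η * X)) =
            64 * K * (P * η⁻¹ ^ 4 * I + 256 * Q * C₁ * η ^ 4 * X * (5 / 4)) := by
          field_simp; ring
        refine le_of_mul_le_mul_left ?_ (by positivity : 0 < η ^ 3)
        rw [h5]
        refine h4.trans ?_
        gcongr
        exact bdist_le x₀
      have hsum : X ≤ 4 * (64 * K * (P * η⁻¹ ^ 7 * I + 320 * Q * C₁ * η * X)) := by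
        refine (Finset.sum_le_sum hterm).trans ?_
        simp
      have h6 := mul_le_mul_of_nonneg_right hηΛ hX0
      rw [hΛ] at h6
      linarith
  intro x hx1 hx2
  have hdx : 1 / 4 ≤ bdist x := le_min (by linarith) (by linarith)
  have h1 := (bdist_pow_mul_jetNorm_le v (by linarith : 0 ≤ bdist x)).trans
    (mul_le_mul_of_nonneg_left (hmax' x (mem_midAnnulus_iff.2 (by linarith))) zero_le_two)
  have h2 : (1 / 4) ^ 7 * jetNorm v x ≤ 2 * X :=
    (mul_le_mul_of_nonneg_right (pow_le_pow_left₀ (by norm_num) hdx 7)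
      (jetNorm_nonneg v x)).trans h1
  calc jetNorm v x ≤ 2 * 4 ^ 7 * X := by linarith
    _ ≤ 2 * 4 ^ 7 * (512 * K * P * η⁻¹ ^ 7 * I) := by gcongr
    _ ≤ _ := by linarith

end Absorption

section LpJet

theorem setIntegral_biUnion_finset_le {ι : Type*} {f : E4 → ℝ} (hf : Integrable f)
    (hf0 : ∀ x, 0 ≤ f x) (t : Finset ι) {S : ι → Set E4} (hS : ∀ i, MeasurableSet (S i)) :
    ∫ x in ⋃ i ∈ t, S i, f x ≤ ∑ i ∈ t, ∫ x in S i, f x := by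
  classical
  induction t using Finset.induction_on with
  | empty => simp
  | insert i t hi ih =>
    have hm : MeasurableSet (⋃ i ∈ t, S i) := t.measurableSet_biUnion fun i _ => hS i
    rw [Finset.set_biUnion_insert, Finset.sum_insert hi, ← Set.union_sdiff_self,
      setIntegral_union Set.disjoint_sdiff_right (hm.diff (hS i)) hf.integrableOn hf.integrableOn]
    gcongr
    exact (setIntegral_mono_set hf.integrableOn (Filter.Eventually.of_forall hf0)
      Set.sdiff_subset.eventuallyLE).trans ih

lemma TestFun.integrable_abs_rpow {f : E4 → ℝ} (hf : TestFun f) {p : ℝ} (hp : 0 < p) :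
    Integrable fun x => |f x| ^ p := by
  refine Continuous.integrable_of_hasCompactSupport ?_ ?_
  · exact hf.continuous.abs.rpow_const fun _ => Or.inr hp.le
  · exact hf.supp.comp_left (g := fun y : ℝ => |y| ^ p) (by simp [ne_of_gt hp])

/-- The closed annulus `{2 ≤ ‖x‖ ≤ 3}`. -/
def innerAnnulus : Set E4 := {x | 2 ≤ ‖x‖ ∧ ‖x‖ ≤ 3}

theorem isCompact_innerAnnulus : IsCompact innerAnnulus := by
  refine (isCompact_closedBall (0 : E4) 3).of_isClosed_subset ?_ ?_
  · exact (isClosed_le continuous_const continuous_norm).inter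
      (isClosed_le continuous_norm continuous_const)
  · intro x hx
    simpa using hx.2

/-- The vector all of whose coordinates are `c`. -/
def diagVec (c : ℝ) : E4 := WithLp.toLp 2 fun _ => c

theorem norm_diagVec {c : ℝ} (hc : 0 ≤ c) : ‖diagVec c‖ = 2 * c := by
  rw [EuclideanSpace.norm_eq, Real.sqrt_eq_iff_mul_self_eq (by positivity) (by positivity)]
  simp [diagVec]
  ring

theorem box_mem_nhds (z : E4) {h : ℝ} (hh : 0 < h) :
    box (z - diagVec (h / 2)) (fun _ => h) ∈ nhds z := by
  have h1 : ∀ i : Fin 4, ∀ᶠ x : E4 in nhds z, x i ∈ Set.Ioo (z i - h / 2) (z i + h / 2) := by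
    intro i
    have hc : Continuous fun x : E4 => x i := by fun_prop
    exact hc.continuousAt.eventually (Ioo_mem_nhds (by linarith) (by linarith))
  filter_upwards [Filter.eventually_all.2 h1] with x hx i
  have h2 : (z - diagVec (h / 2)) i = z i - h / 2 := by simp [diagVec]
  rw [h2]
  exact ⟨(hx i).1.le, by linarith [(hx i).2]⟩

theorem exists_integral_pds_rpow_bound {p : ℝ} (hp : 0 < p) : ∃ C, 0 < C ∧
    ∀ u : E4 → ℝ, TestFun u → ∀ l : List (Fin 4), l.length = 4 → ∀ M, 0 < M →
    (∀ y : E4, 3 / 2 ≤ ‖y‖ → ‖y‖ ≤ 7 / 2 → |u y| ≤ M) →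
    (∀ y : E4, 3 / 2 ≤ ‖y‖ → ‖y‖ ≤ 7 / 2 → |lapl (lapl u) y| ≤ M) →
    ∫ x in innerAnnulus, |pds l u x| ^ p ≤ C * M ^ p := by
  obtain ⟨C, hC, hbox⟩ := exists_Lp_bound (s := 1 / 12) (p := p) (by norm_num) hp
  have hside : side ((1 / 12 : ℝ) / 2) 0 = fun _ => (1 / 24 : ℝ) := by
    funext j
    fin_cases j <;> norm_num [side]
  rw [hside] at hbox
  obtain ⟨t, ht, hcover⟩ := isCompact_innerAnnulus.elim_nhds_subcover
    (fun z => box (z - diagVec (1 / 24 / 2)) (fun _ => 1 / 24))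
    (fun z _ => box_mem_nhds z (by norm_num))
  refine ⟨(t.card + 1) * C, by positivity, ?_⟩
  intro u hu l hl M hM hu1 hu2
  have hint := (hu.pds l).integrable_abs_rpow hp
  have hnn : ∀ x, 0 ≤ |pds l u x| ^ p := fun x => by positivity
  have hnear : ∀ z ∈ t, ∀ y ∈ closedBall (z - diagVec (1 / 24 / 2)) (5 * (1 / 12)),
      3 / 2 ≤ ‖y‖ ∧ ‖y‖ ≤ 7 / 2 := by
    intro z hz y hy
    rw [mem_closedBall, dist_eq_norm] at hy
    have h1 : ‖y - z‖ ≤ 1 / 2 := by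
      have h2 : y - z = (y - (z - diagVec (1 / 24 / 2))) - diagVec (1 / 24 / 2) := by abel
      rw [h2]
      refine (norm_sub_le _ _).trans ?_
      rw [norm_diagVec (by norm_num)]
      linarith
    have h3 := abs_le.1 ((abs_norm_sub_norm_le y z).trans h1)
    have h4 := ht z hz
    exact ⟨by linarith [h4.1], by linarith [h4.2]⟩
  calc ∫ x in innerAnnulus, |pds l u x| ^ p
      ≤ ∫ x in ⋃ z ∈ t, box (z - diagVec (1 / 24 / 2)) (fun _ => 1 / 24), |pds l u x| ^ p :=
        setIntegral_mono_set hint.integrableOn (Filter.Eventually.of_forall hnn)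
          hcover.eventuallyLE
    _ ≤ ∑ z ∈ t, ∫ x in box (z - diagVec (1 / 24 / 2)) (fun _ => 1 / 24), |pds l u x| ^ p :=
        setIntegral_biUnion_finset_le hint hnn t fun z => measurableSet_box _ _
    _ ≤ ∑ _z ∈ t, C * M ^ p := by
        refine Finset.sum_le_sum fun z hz => hbox u hu l hl M hM _ ?_ ?_
        · exact fun y hy => hu1 y (hnear z hz y hy).1 (hnear z hz y hy).2
        · exact fun y hy => hu2 y (hnear z hz y hy).1 (hnear z hz y hy).2
    _ = t.card * (C * M ^ p) := by simp
    _ ≤ _ := by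
        have : 0 ≤ C * M ^ p := by positivity
        linarith

theorem exists_Lp_jet_bound (K : ℕ) {p C₁ : ℝ} (hp : 1 < p) (hC₁ : 0 < C₁) :
    ∃ C : ℝ, 0 < C ∧ ∀ v : E4 → EuclideanSpace ℝ (Fin K), ContDiff ℝ (⊤ : ℕ∞) v →
      (∀ k, TestFun (coord v k)) →
      (∀ x ∈ midAnnulus, ∀ B, (∀ z, ‖z‖ = ‖x‖ → jetNorm v z ≤ B) →
        ∀ k, |lapl (lapl (coord v k)) x| ≤ C₁ * B) →
      ∀ M, 0 < M → ∫ y in midAnnulus, ‖v y‖ ≤ M → ∀ j < 5,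
        ∫ x in innerAnnulus, ‖iteratedFDeriv ℝ j v x‖ ^ p ≤ C * M ^ p := by
  have hp0 : 0 < p := by linarith
  obtain ⟨D, hD, hjet⟩ := exists_jetNorm_bound K hC₁
  obtain ⟨D', hD', hpds⟩ := exists_integral_pds_rpow_bound hp0
  set E := (1 + C₁) * D with hE
  have hE0 : 0 < E := by positivity
  obtain ⟨N, hN⟩ : ∃ N : ℝ, N = ((Finset.univ : Finset ((Fin 4 → Fin 4) × Fin K)).card : ℝ) :=
    ⟨_, rfl⟩
  have hN1 : 0 ≤ N := by rw [hN]; exact Nat.cast_nonneg _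
  refine ⟨volume.real innerAnnulus * D ^ p + N ^ (p - 1) * (N * (D' * E ^ p)) + 1,
    by positivity, ?_⟩
  intro v hv hvk hyp M hM hIM j hj
  have hT : ∀ x : E4, 3 / 2 ≤ ‖x‖ → ‖x‖ ≤ 7 / 2 → jetNorm v x ≤ D * M := fun x h1 h2 =>
    (hjet v hv hvk hyp x h1 h2).trans (by gcongr)
  have hMp : 0 < M ^ p := by positivity
  have hv0 : 0 ≤ volume.real innerAnnulus * D ^ p := by positivity
  have hN0 : 0 ≤ N ^ (p - 1) * (N * (D' * E ^ p)) := by positivity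
  rcases Nat.lt_or_ge j 4 with hj4 | hj4
  · calc ∫ x in innerAnnulus, ‖iteratedFDeriv ℝ j v x‖ ^ p
        ≤ ∫ _x in innerAnnulus, (D * M) ^ p := by
          refine setIntegral_mono_on ?_ ?_ isCompact_innerAnnulus.measurableSet fun x hx => ?_
          · refine ContinuousOn.integrableOn_compact isCompact_innerAnnulus
              (Continuous.continuousOn ?_)
            exact (hv.continuous_iteratedFDeriv (by exact_mod_cast le_top)).norm.rpow_const
              fun _ => Or.inr hp0.le
          · exact integrableOn_const isCompact_innerAnnulus.measure_lt_top.ne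
          · refine Real.rpow_le_rpow (norm_nonneg _) ?_ hp0.le
            exact (norm_iteratedFDeriv_le_jetNorm v x hj4).trans
              (hT x (by linarith [hx.1]) (by linarith [hx.2]))
      _ = volume.real innerAnnulus * D ^ p * M ^ p := by
          rw [setIntegral_const, smul_eq_mul, Real.mul_rpow hD.le hM.le]; ring
      _ ≤ _ := by
          gcongr
          linarith
  · obtain rfl : j = 4 := by omega
    have hcoord : ∀ k, ∀ y : E4, 3 / 2 ≤ ‖y‖ → ‖y‖ ≤ 7 / 2 → |coord v k y| ≤ E * M := by
      intro k y h1 h2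
      have h3 := (norm_iteratedFDeriv_le_jetNorm v y (j := 0) (by norm_num)).trans (hT y h1 h2)
      rw [norm_iteratedFDeriv_zero] at h3
      have h4 : 0 ≤ C₁ * D * M := by positivity
      rw [hE]
      linarith [abs_coord_le (v y) k, show |coord v k y| = |v y k| from rfl]
    have hlap : ∀ k, ∀ y : E4, 3 / 2 ≤ ‖y‖ → ‖y‖ ≤ 7 / 2 →
        |lapl (lapl (coord v k)) y| ≤ E * M := by
      intro k y h1 h2
      have h3 := hyp y ⟨by linarith, by linarith⟩ (D * M)
        (fun z hz => hT z (hz ▸ h1) (hz ▸ h2)) k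
      have h4 : 0 ≤ D * M := by positivity
      rw [hE]
      linarith
    have hbd : ∀ q : (Fin 4 → Fin 4) × Fin K,
        ∫ x in innerAnnulus, |pds (List.ofFn q.1) (coord v q.2) x| ^ p ≤ D' * (E * M) ^ p :=
      fun q => hpds _ (hvk q.2) _ (List.length_ofFn) _ (by positivity) (hcoord q.2) (hlap q.2)
    have hint : ∀ q : (Fin 4 → Fin 4) × Fin K,
        IntegrableOn (fun x => |pds (List.ofFn q.1) (coord v q.2) x| ^ p) innerAnnulus :=
      fun q => (((hvk q.2).pds _).integrable_abs_rpow hp0).integrableOn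
    calc ∫ x in innerAnnulus, ‖iteratedFDeriv ℝ 4 v x‖ ^ p
        ≤ ∫ x in innerAnnulus, N ^ (p - 1) * ∑ q : (Fin 4 → Fin 4) × Fin K,
            |pds (List.ofFn q.1) (coord v q.2) x| ^ p := by
          refine integral_mono_of_nonneg (Filter.Eventually.of_forall fun x => by positivity)
            ((integrable_finsetSum _ fun q _ => hint q).const_mul _)
            (Filter.Eventually.of_forall fun x => ?_)
          rw [hN]
          refine le_trans ?_ (Real.rpow_sum_le_const_mul_sum_rpow Finset.univ
            (fun q : (Fin 4 → Fin 4) × Fin K => pds (List.ofFn q.1) (coord v q.2) x) hp.le)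
          refine Real.rpow_le_rpow (norm_nonneg _) ?_ hp0.le
          rw [Fintype.sum_prod_type]
          exact norm_iteratedFDeriv_le_sum_pds hv 4 x
      _ = N ^ (p - 1) * ∑ q : (Fin 4 → Fin 4) × Fin K,
            ∫ x in innerAnnulus, |pds (List.ofFn q.1) (coord v q.2) x| ^ p := by
          rw [integral_const_mul, integral_finsetSum _ fun q _ => hint q]
      _ ≤ N ^ (p - 1) * ∑ _q : (Fin 4 → Fin 4) × Fin K, D' * (E * M) ^ p :=
          mul_le_mul_of_nonneg_left (Finset.sum_le_sum fun q _ => hbd q)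
            (Real.rpow_nonneg hN1 _)
      _ = N ^ (p - 1) * (N * (D' * E ^ p)) * M ^ p := by
          rw [Finset.sum_const, nsmul_eq_mul, ← hN, Real.mul_rpow hE0.le hM.le]; ring
      _ ≤ _ := by
          gcongr
          linarith

end LpJet

section Cutoff

/-- A smooth cutoff on ℝ⁴ for the annulus `{1 ≤ ‖x‖ ≤ 4}`. -/
theorem exists_annulus_cutoff : ∃ θ : E4 → ℝ, ContDiff ℝ (⊤ : ℕ∞) θ ∧
    (∀ x, 6 / 5 ≤ ‖x‖ → ‖x‖ ≤ 19 / 5 → θ x = 1) ∧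
    (∀ x, ‖x‖ ≤ 11 / 10 → θ x = 0) ∧ ∀ x, 39 / 10 ≤ ‖x‖ → θ x = 0 := by
  let f : ContDiffBump (0 : E4) := ⟨11 / 10, 6 / 5, by norm_num, by norm_num⟩
  let g : ContDiffBump (0 : E4) := ⟨19 / 5, 39 / 10, by norm_num, by norm_num⟩
  refine ⟨fun x => g x * (1 - f x), g.contDiff.mul (contDiff_const.sub f.contDiff),
    fun x h1 h2 => ?_, fun x h => ?_, fun x h => ?_⟩
  · have hg : g x = 1 := g.one_of_mem_closedBall (by simpa [g] using h2)
    have hf : f x = 0 := f.zero_of_le_dist (by simpa [f] using h1)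
    simp [hg, hf]
  · have hf : f x = 1 := f.one_of_mem_closedBall (by simpa [f] using h)
    simp [hf]
  · have hg : g x = 0 := g.zero_of_le_dist (by simpa [g] using h)
    simp [hg]

theorem exists_compactSupport_extension {K : ℕ} {u : E4 → EuclideanSpace ℝ (Fin K)}
    (hu : ContDiffOn ℝ (⊤ : ℕ∞) u {x : E4 | 1 ≤ ‖x‖ ∧ ‖x‖ ≤ 4}) :
    ∃ v : E4 → EuclideanSpace ℝ (Fin K), ContDiff ℝ (⊤ : ℕ∞) v ∧ (∀ k, TestFun (coord v k)) ∧
      ∀ x, 6 / 5 ≤ ‖x‖ → ‖x‖ ≤ 19 / 5 → v x = u x := by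
  obtain ⟨θ, hθ, h1, h2, h3⟩ := exists_annulus_cutoff
  have hv : ContDiff ℝ (⊤ : ℕ∞) fun x => θ x • u x := by
    refine contDiff_iff_contDiffAt.2 fun x => ?_
    rcases lt_or_ge ‖x‖ (11 / 10) with h | h
    · refine (contDiffAt_const (c := 0)).congr_of_eventuallyEq ?_
      filter_upwards [continuous_norm.continuousAt.eventually (gt_mem_nhds h)] with y hy
      rw [h2 y hy.le, zero_smul]
    rcases lt_or_ge (39 / 10) ‖x‖ with h' | h'
    · refine (contDiffAt_const (c := 0)).congr_of_eventuallyEq ?_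
      filter_upwards [continuous_norm.continuousAt.eventually (lt_mem_nhds h')] with y hy
      rw [h3 y hy.le, zero_smul]
    · refine hθ.contDiffAt.smul (hu.contDiffAt ?_)
      filter_upwards [continuous_norm.continuousAt.eventually
          (lt_mem_nhds (by linarith : 1 < ‖x‖)),
        continuous_norm.continuousAt.eventually (gt_mem_nhds (by linarith : ‖x‖ < 4))]
        with y hy1 hy2
      exact ⟨hy1.le, hy2.le⟩
  refine ⟨_, hv, fun k => ⟨hv.coord k, ?_⟩, fun x hx1 hx2 => by rw [h1 x hx1 hx2, one_smul]⟩
  refine HasCompactSupport.intro (isCompact_closedBall (0 : E4) 4) fun x hx => ?_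
  have hx' : 39 / 10 ≤ ‖x‖ := by
    rw [mem_closedBall, dist_zero_right, not_le] at hx
    linarith
  simp [coord, h3 x hx']

variable {V : Type*} [NormedAddCommGroup V] [NormedSpace ℝ V]

theorem Filter.EventuallyEq.lap {f g : E4 → V} {x : E4} (h : f =ᶠ[nhds x] g) :
    lap f =ᶠ[nhds x] lap g := by
  filter_upwards [h.iteratedFDeriv ℝ 2] with y hy
  rw [_root_.lap, _root_.lap, hy]

theorem ApproxBiharmonicEqOn.norm_lap_lap_le {K : ℕ} {S : Set E4}
    {u v : E4 → EuclideanSpace ℝ (Fin K)}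
    {a₁ : E4 → (E4 →L[ℝ] EuclideanSpace ℝ (Fin K)) →L[ℝ] EuclideanSpace ℝ (Fin K)}
    {a₂ : E4 → (E4 →L[ℝ] E4 →L[ℝ] EuclideanSpace ℝ (Fin K)) →L[ℝ] EuclideanSpace ℝ (Fin K)}
    {a₃ : E4 → (E4 →L[ℝ] EuclideanSpace ℝ (Fin K)) →L[ℝ] EuclideanSpace ℝ (Fin K)}
    {a₄ : E4 → EuclideanSpace ℝ (Fin K) →L[ℝ] EuclideanSpace ℝ (Fin K)}
    {b₁ : E4 → (E4 →L[ℝ] EuclideanSpace ℝ (Fin K)) →L[ℝ] EuclideanSpace ℝ (Fin K)}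
    {b₂ : E4 → (E4 →L[ℝ] E4 →L[ℝ] EuclideanSpace ℝ (Fin K)) →L[ℝ] EuclideanSpace ℝ (Fin K)}
    {b₃ : E4 → (E4 →L[ℝ] EuclideanSpace ℝ (Fin K)) →L[ℝ] EuclideanSpace ℝ (Fin K)}
    {b₄ : E4 → EuclideanSpace ℝ (Fin K) →L[ℝ] EuclideanSpace ℝ (Fin K)} {C₀ : ℝ}
    (heq : ApproxBiharmonicEqOn S u a₁ a₂ a₃ a₄ b₁ b₂ b₃ b₄)
    (hC : ∀ x ∈ S,
      ‖a₁ x‖ + ‖a₂ x‖ + ‖a₃ x‖ + ‖a₄ x‖ + ‖b₁ x‖ + ‖b₂ x‖ + ‖b₃ x‖ + ‖b₄ x‖ ≤ C₀)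
    (hv : ContDiff ℝ (⊤ : ℕ∞) v) {x : E4} (hxS : ∀ z, ‖z‖ = ‖x‖ → z ∈ S)
    (hvu : ∀ z, ‖z‖ = ‖x‖ → v =ᶠ[nhds z] u) {B : ℝ}
    (hB : ∀ z, ‖z‖ = ‖x‖ → jetNorm v z ≤ B) :
    ‖lap (lap v) x‖ ≤ 8 * C₀ * B := by
  have hB0 : 0 ≤ B := (jetNorm_nonneg v x).trans (hB x rfl)
  have hC₀ : 0 ≤ C₀ := le_trans (by positivity) (hC x (hxS x rfl))
  have key : ∀ z, ‖z‖ = ‖x‖ → fderiv ℝ (lap u) z = fderiv ℝ (lap v) z ∧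
      fderiv ℝ (fderiv ℝ u) z = fderiv ℝ (fderiv ℝ v) z ∧ fderiv ℝ u z = fderiv ℝ v z ∧
      u z = v z := fun z hz =>
    ⟨(hvu z hz).symm.lap.fderiv_eq, (hvu z hz).symm.fderiv.fderiv_eq,
      (hvu z hz).symm.fderiv_eq, (hvu z hz).symm.eq_of_nhds⟩
  rw [(hvu x rfl).lap.lap.eq_of_nhds, heq x (hxS x rfl)]
  have h1 : ‖a₁ x (fderiv ℝ (lap u) x) + a₂ x (fderiv ℝ (fderiv ℝ u) x) + a₃ x (fderiv ℝ u x) +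
      a₄ x (u x)‖ ≤ 4 * C₀ * B := by
    obtain ⟨e1, e2, e3, e4⟩ := key x rfl
    rw [e1, e2, e3, e4]
    refine norm_coeff_sum_le hv _ _ _ _ ?_ (hB x rfl)
    have h := hC x (hxS x rfl)
    have hb : 0 ≤ ‖b₁ x‖ + ‖b₂ x‖ + ‖b₃ x‖ + ‖b₄ x‖ := by positivity
    linarith
  have h2 : ‖sphereAvg ‖x‖ (fun y => b₁ y (fderiv ℝ (lap u) y) +
      b₂ y (fderiv ℝ (fderiv ℝ u) y) + b₃ y (fderiv ℝ u y) + b₄ y (u y))‖ ≤ 4 * C₀ * B := by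
    refine norm_sphereAvg_le (by positivity) fun y hy => ?_
    have hy' : ‖y‖ = ‖x‖ := by simpa using hy
    obtain ⟨e1, e2, e3, e4⟩ := key y hy'
    rw [e1, e2, e3, e4]
    refine norm_coeff_sum_le hv _ _ _ _ ?_ (hB y hy')
    have h := hC y (hxS y hy')
    have ha : 0 ≤ ‖a₁ y‖ + ‖a₂ y‖ + ‖a₃ y‖ + ‖a₄ y‖ := by positivity
    linarith
  refine (norm_add_le _ _).trans ?_
  linarith

theorem setIntegral_norm_le_rpow {W : Type*} [NormedAddCommGroup W] {v : E4 → W}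
    (hv : Continuous v) {p : ℝ} (hp : 1 < p) {S : Set E4} (hS : IsCompact S) :
    ∫ x in S, ‖v x‖ ≤
      volume.real S ^ (1 - 1 / p) * (∫ x in S, ‖v x‖ ^ p) ^ (1 / p) := by
  have hpq := Real.HolderConjugate.conjExponent hp
  have : IsFiniteMeasure (volume.restrict S) := ⟨by simpa using hS.measure_lt_top⟩
  obtain ⟨D, hD⟩ := hS.exists_bound_of_continuousOn hv.norm.continuousOn
  have hmem : MemLp (fun x => ‖v x‖) (ENNReal.ofReal p) (volume.restrict S) :=
    MemLp.of_bound hv.norm.aestronglyMeasurable D ((ae_restrict_iff' hS.measurableSet).2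
      (Filter.Eventually.of_forall hD))
  have h := integral_mul_le_Lp_mul_Lq_of_nonneg (μ := volume.restrict S) hpq
    (f := fun x => ‖v x‖) (g := fun _ => 1)
    (Filter.Eventually.of_forall fun _ => norm_nonneg _)
    (Filter.Eventually.of_forall fun _ => zero_le_one) hmem (memLp_const 1)
  simp only [mul_one, Real.one_rpow, setIntegral_const, smul_eq_mul] at h
  have h2 : 1 / p.conjExponent = 1 - 1 / p := by
    rw [one_div, one_div]; linarith [hpq.inv_add_inv_eq_one]
  rw [h2, mul_comm] at h
  exact h

end Cutoff

/-- Interior `L^p` estimate for approximate biharmonic functions on the annulus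
`{1 ≤ |x| ≤ 4}` with uniformly bounded coefficients: for `p > 1` and `C₀ > 0` there is a
constant `C = C(p, C₀, K)` such that
`Σ_{j=0}^{4} ‖∇ʲu‖_{L^p(B₃∖B₂)} ≤ C ‖u‖_{L^p(B₄∖B₁)}`. -/
theorem lp_estimate_approx_biharmonic (K : ℕ) (p C₀ : ℝ) (hp : 1 < p) (hC₀ : 0 < C₀) :
    ∃ C : ℝ, 0 < C ∧
      ∀ (u : EuclideanSpace ℝ (Fin 4) → EuclideanSpace ℝ (Fin K))
        (a₁ : EuclideanSpace ℝ (Fin 4) →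
          (EuclideanSpace ℝ (Fin 4) →L[ℝ] EuclideanSpace ℝ (Fin K)) →L[ℝ]
            EuclideanSpace ℝ (Fin K))
        (a₂ : EuclideanSpace ℝ (Fin 4) →
          (EuclideanSpace ℝ (Fin 4) →L[ℝ] EuclideanSpace ℝ (Fin 4) →L[ℝ]
            EuclideanSpace ℝ (Fin K)) →L[ℝ] EuclideanSpace ℝ (Fin K))
        (a₃ : EuclideanSpace ℝ (Fin 4) →
          (EuclideanSpace ℝ (Fin 4) →L[ℝ] EuclideanSpace ℝ (Fin K)) →L[ℝ]
            EuclideanSpace ℝ (Fin K))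
        (a₄ : EuclideanSpace ℝ (Fin 4) →
          EuclideanSpace ℝ (Fin K) →L[ℝ] EuclideanSpace ℝ (Fin K))
        (b₁ : EuclideanSpace ℝ (Fin 4) →
          (EuclideanSpace ℝ (Fin 4) →L[ℝ] EuclideanSpace ℝ (Fin K)) →L[ℝ]
            EuclideanSpace ℝ (Fin K))
        (b₂ : EuclideanSpace ℝ (Fin 4) →
          (EuclideanSpace ℝ (Fin 4) →L[ℝ] EuclideanSpace ℝ (Fin 4) →L[ℝ]
            EuclideanSpace ℝ (Fin K)) →L[ℝ] EuclideanSpace ℝ (Fin K))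
        (b₃ : EuclideanSpace ℝ (Fin 4) →
          (EuclideanSpace ℝ (Fin 4) →L[ℝ] EuclideanSpace ℝ (Fin K)) →L[ℝ]
            EuclideanSpace ℝ (Fin K))
        (b₄ : EuclideanSpace ℝ (Fin 4) →
          EuclideanSpace ℝ (Fin K) →L[ℝ] EuclideanSpace ℝ (Fin K)),
        ContDiffOn ℝ (⊤ : ℕ∞) u {x : EuclideanSpace ℝ (Fin 4) | 1 ≤ ‖x‖ ∧ ‖x‖ ≤ 4} →
        ApproxBiharmonicEqOn {x : EuclideanSpace ℝ (Fin 4) | 1 ≤ ‖x‖ ∧ ‖x‖ ≤ 4} u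
          a₁ a₂ a₃ a₄ b₁ b₂ b₃ b₄ →
        (∀ x ∈ {x : EuclideanSpace ℝ (Fin 4) | 1 ≤ ‖x‖ ∧ ‖x‖ ≤ 4},
          ‖a₁ x‖ + ‖a₂ x‖ + ‖a₃ x‖ + ‖a₄ x‖ + ‖b₁ x‖ + ‖b₂ x‖ + ‖b₃ x‖ + ‖b₄ x‖ ≤ C₀) →
        ∑ j ∈ Finset.range 5,
            (∫ x in {x : EuclideanSpace ℝ (Fin 4) | 2 ≤ ‖x‖ ∧ ‖x‖ ≤ 3},
              ‖iteratedFDeriv ℝ j u x‖ ^ p) ^ (1 / p) ≤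
          C * (∫ x in {x : EuclideanSpace ℝ (Fin 4) | 1 ≤ ‖x‖ ∧ ‖x‖ ≤ 4},
              ‖u x‖ ^ p) ^ (1 / p) := by
  have hp0 : 0 < p := by linarith
  obtain ⟨D, hD, hjet⟩ := exists_Lp_jet_bound K hp (by positivity : 0 < 8 * C₀)
  set c := volume.real midAnnulus ^ (1 - 1 / p) with hc
  have hc0 : 0 ≤ c := Real.rpow_nonneg measureReal_nonneg _
  set E := 5 * D ^ (1 / p) with hE
  have hE0 : 0 < E := by positivity
  refine ⟨E * (c + 1), by positivity, ?_⟩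
  intro u a₁ a₂ a₃ a₄ b₁ b₂ b₃ b₄ hu heq hC
  obtain ⟨v, hv, hvk, hvu⟩ := exists_compactSupport_extension hu
  have hvu' : ∀ x : E4, 5 / 4 ≤ ‖x‖ → ‖x‖ ≤ 15 / 4 → v =ᶠ[nhds x] u := by
    intro x h1 h2
    filter_upwards [continuous_norm.continuousAt.eventually
        (lt_mem_nhds (by linarith : 6 / 5 < ‖x‖)),
      continuous_norm.continuousAt.eventually (gt_mem_nhds (by linarith : ‖x‖ < 19 / 5))]
      with y hy1 hy2
    exact hvu y hy1.le hy2.le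
  have hyp : ∀ x ∈ midAnnulus, ∀ B, (∀ z, ‖z‖ = ‖x‖ → jetNorm v z ≤ B) →
      ∀ k, |lapl (lapl (coord v k)) x| ≤ 8 * C₀ * B := by
    intro x hx B hB k
    rw [lapl_coord hv, lapl_coord (contDiff_lap hv)]
    refine (abs_coord_le _ k).trans (heq.norm_lap_lap_le hC hv (fun z hz => ?_)
      (fun z hz => hvu' z (hz.symm ▸ hx.1) (hz.symm ▸ hx.2)) hB)
    exact ⟨by linarith [hx.1], by linarith [hx.2]⟩
  set T : Set E4 := {x | 1 ≤ ‖x‖ ∧ ‖x‖ ≤ 4} with hT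
  have hTc : IsCompact T := by
    refine (isCompact_closedBall (0 : E4) 4).of_isClosed_subset ?_ fun x hx => ?_
    · exact (isClosed_le continuous_const continuous_norm).inter
        (isClosed_le continuous_norm continuous_const)
    · simpa using hx.2
  set J := (∫ x in T, ‖u x‖ ^ p) ^ (1 / p) with hJ
  have hvJ : ∫ y in midAnnulus, ‖v y‖ ≤ c * J := by
    refine (setIntegral_norm_le_rpow hv.continuous hp isCompact_midAnnulus).trans ?_
    refine mul_le_mul_of_nonneg_left (Real.rpow_le_rpow
      (integral_nonneg fun x => by positivity) ?_ (by positivity)) hc0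
    calc ∫ x in midAnnulus, ‖v x‖ ^ p = ∫ x in midAnnulus, ‖u x‖ ^ p := by
          refine setIntegral_congr_fun isCompact_midAnnulus.measurableSet fun x hx => ?_
          simp only [(hvu' x hx.1 hx.2).eq_of_nhds]
      _ ≤ ∫ x in T, ‖u x‖ ^ p := by
          refine setIntegral_mono_set ?_ (Filter.Eventually.of_forall fun x => by positivity)
            (LE.le.eventuallyLE fun x hx => ?_)
          · exact (hu.continuousOn.norm.rpow_const
              fun _ _ => Or.inr hp0.le).integrableOn_compact hTc
          · exact ⟨by linarith [hx.1], by linarith [hx.2]⟩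
  have hJ0 : 0 ≤ J := Real.rpow_nonneg (integral_nonneg fun x => by positivity) _
  refine le_of_forall_pos_le_add fun ε hε => ?_
  have hM : 0 < c * J + ε / E := by positivity
  calc ∑ j ∈ Finset.range 5, (∫ x in innerAnnulus, ‖iteratedFDeriv ℝ j u x‖ ^ p) ^ (1 / p)
      ≤ ∑ _j ∈ Finset.range 5, D ^ (1 / p) * (c * J + ε / E) := by
        refine Finset.sum_le_sum fun j hj => ?_
        have h1 : ∫ x in innerAnnulus, ‖iteratedFDeriv ℝ j u x‖ ^ p =
            ∫ x in innerAnnulus, ‖iteratedFDeriv ℝ j v x‖ ^ p := by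
          refine setIntegral_congr_fun isCompact_innerAnnulus.measurableSet fun x hx => ?_
          simp only [((hvu' x (by linarith [hx.1]) (by linarith [hx.2])).iteratedFDeriv
            ℝ j).eq_of_nhds]
        have h2 := hjet v hv hvk hyp _ hM
          (hvJ.trans (le_add_of_nonneg_right (by positivity))) j (Finset.mem_range.1 hj)
        rw [h1]
        calc _ ≤ (D * (c * J + ε / E) ^ p) ^ (1 / p) := Real.rpow_le_rpow
              (integral_nonneg fun x => by positivity) h2 (by positivity)
          _ = _ := by
              rw [Real.mul_rpow hD.le (by positivity), ← Real.rpow_mul hM.le,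
                mul_one_div_cancel hp0.ne', Real.rpow_one]
    _ = E * (c * J) + ε := by
        rw [Finset.sum_const, Finset.card_range, nsmul_eq_mul]
        push_cast
        rw [← mul_assoc, ← hE, mul_add, mul_div_cancel₀ _ hE0.ne']
    _ ≤ E * (c + 1) * J + ε := by
        have : 0 ≤ E * J := by positivity
        linarith
end
end

section
/- Let L > 0 and let l₀ < l₁ be integers. Suppose F : {l₀, l₀+1, …, l₁} → [0, ∞) satisfies, for every integer l with l₀ < l < l₁: (a) if F(l+1) ≤ e^{−L} F(l) then F(l) ≤ e^{−L} F(l−1); (b) if F(l−1) ≤ e^{−L} F(l) then F(l) ≤ e^{−L} F(l+1); and (c) F(l) ≤ e^{−L} F(l−1) or F(l) ≤ e^{−L} F(l+1). Then for every l with l₀ ≤ l ≤ l₁, F(l) ≤ e^{−L(l−l₀)} F(l₀) + e^{−L(l₁−l)} F(l₁). -/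
/-- If the decay `F (l + 1) ≤ e^{-L} F l` propagates backwards along `(a, b)`, then decay at one
index of the interval gives exponential decay from the left endpoint. -/
theorem le_exp_mul_of_decay_propagates (L : ℝ) (a b : ℤ) (F : ℤ → ℝ)
    (h : ∀ l : ℤ, a < l → l < b →
      (F (l + 1) ≤ Real.exp (-L) * F l → F l ≤ Real.exp (-L) * F (l - 1)))
    (l : ℤ) (hal : a ≤ l) (hlb : l < b)
    (hdecay : a < l → F l ≤ Real.exp (-L) * F (l - 1)) :
    F l ≤ Real.exp (-L * ((l : ℝ) - (a : ℝ))) * F a := by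
  induction l, hal using Int.leInduction with
  | base => simp
  | succ l hal ih =>
    have hstep : F (l + 1) ≤ Real.exp (-L) * F l := by
      simpa using hdecay (by lia)
    have hl := ih (by lia) fun hal' => h l hal' (by lia) hstep
    calc
      F (l + 1) ≤ Real.exp (-L) * F l := hstep
      _ ≤ Real.exp (-L) * (Real.exp (-L * ((l : ℝ) - (a : ℝ))) * F a) := by gcongr
      _ = Real.exp (-L * (((l + 1 : ℤ) : ℝ) - (a : ℝ))) * F a := by
        rw [← mul_assoc, ← Real.exp_add]
        congr 2
        push_cast
        ring


/-- Discrete three-circle iteration: if `F : {l₀, …, l₁} → [0,∞)` satisfies the three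
alternatives (a), (b), (c) at every interior index, then
`F(l) ≤ e^{-L(l-l₀)} F(l₀) + e^{-L(l₁-l)} F(l₁)` for all `l₀ ≤ l ≤ l₁`. -/
theorem discrete_three_circle_decay (L : ℝ) (hL : 0 < L) (l₀ l₁ : ℤ) (hl : l₀ < l₁)
    (F : ℤ → ℝ)
    (hnonneg : ∀ l : ℤ, l₀ ≤ l → l ≤ l₁ → 0 ≤ F l)
    (ha : ∀ l : ℤ, l₀ < l → l < l₁ →
      (F (l + 1) ≤ Real.exp (-L) * F l → F l ≤ Real.exp (-L) * F (l - 1)))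
    (hb : ∀ l : ℤ, l₀ < l → l < l₁ →
      (F (l - 1) ≤ Real.exp (-L) * F l → F l ≤ Real.exp (-L) * F (l + 1)))
    (hc : ∀ l : ℤ, l₀ < l → l < l₁ →
      (F l ≤ Real.exp (-L) * F (l - 1) ∨ F l ≤ Real.exp (-L) * F (l + 1))) :
    ∀ l : ℤ, l₀ ≤ l → l ≤ l₁ →
      F l ≤ Real.exp (-L * ((l : ℝ) - (l₀ : ℝ))) * F l₀ +
        Real.exp (-L * ((l₁ : ℝ) - (l : ℝ))) * F l₁ := by
  intro l hl₀ hl₁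
  have h₀ := hnonneg l₀ le_rfl hl.le
  have h₁ := hnonneg l₁ hl.le le_rfl
  rcases hl₀.eq_or_lt with rfl | hlt₀
  · simpa using mul_nonneg (Real.exp_nonneg _) h₁
  rcases hl₁.eq_or_lt with rfl | hlt₁
  · simpa using mul_nonneg (Real.exp_nonneg _) h₀
  rcases hc l hlt₀ hlt₁ with hP | hQ
  · exact le_add_of_le_of_nonneg
      (le_exp_mul_of_decay_propagates L l₀ l₁ F ha l hl₀ hlt₁ fun _ => hP)
      (mul_nonneg (Real.exp_nonneg _) h₁)
  · have hreflect := le_exp_mul_of_decay_propagates L (-l₁) (-l₀) (fun m => F (-m))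
      (fun m hm₁ hm₀ hm => by
        have := hb (-m) (by lia) (by lia)
        rw [show -m - 1 = -(m + 1) by ring, show -m + 1 = -(m - 1) by ring] at this
        exact this hm)
      (-l) (by lia) (by lia)
      (fun _ => by simpa [add_comm] using hQ)
    refine le_add_of_nonneg_of_le (mul_nonneg (Real.exp_nonneg _) h₀) ?_
    have hexponent : ((-l : ℤ) : ℝ) - ((-l₁ : ℤ) : ℝ) = (l₁ : ℝ) - (l : ℝ) := by
      push_cast
      ring
    simpa only [neg_neg, hexponent] using hreflect
end
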